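/- arXiv:0902.0807 — 3 statements merged into one kernel-verified Lean document; each statement's English description precedes it below -/
import Mathlib

section
/- Let d ≥ 6. There exists a constant C = C(d) such that for all measurable w, h : ℝ^d → ℂ with |w(x)| ≤ W(x)/4 for almost every x ∈ ℝ^d, one has ‖R(h+w) − R(w)‖_{L^{2d/(d+2)}(ℝ^d)} ≤ C ( ‖h‖_{L^{2d/(d−2)}(ℝ^d)}^{p_c} + ‖W^{−1}w‖_{L^∞(ℝ^d)} ‖h‖_{L^{2d/(d−2)}(ℝ^d)} ). -/
open MeasureTheory
open scoped ENNReal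

noncomputable section

/-- ℝ^d as Euclidean space -/
abbrev Euc (d : ℕ) := EuclideanSpace ℝ (Fin d)

/-- The ground state W(x) = (1 + |x|²/(d(d−2)))^{−(d−2)/2}. -/
def Wgs (d : ℕ) (x : Euc d) : ℝ :=
  (1 + ‖x‖ ^ 2 / ((d : ℝ) * ((d : ℝ) - 2))) ^ (-(((d : ℝ) - 2) / 2))

/-- p_c = (d+2)/(d-2) -/
def pc (d : ℕ) : ℝ := ((d : ℝ) + 2) / ((d : ℝ) - 2)

/-- R(v) = −i(|v+W|^{p_c−1}(v+W) − W^{p_c} − ((p_c+1)/2)W^{p_c−1}v − ((p_c−1)/2)W^{p_c−1}v̄). -/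
def Rnl (d : ℕ) (v : Euc d → ℂ) (x : Euc d) : ℂ :=
  -Complex.I * ((↑(‖v x + (Wgs d x : ℂ)‖ ^ (pc d - 1)) : ℂ) * (v x + (Wgs d x : ℂ))
    - (↑((Wgs d x) ^ (pc d)) : ℂ)
    - (↑((pc d + 1) / 2 * (Wgs d x) ^ (pc d - 1)) : ℂ) * v x
    - (↑((pc d - 1) / 2 * (Wgs d x) ^ (pc d - 1)) : ℂ) * (starRingEnd ℂ (v x)))

/-- The second-order remainder of `z ↦ ‖z‖ ^ (p - 1) * z` expanded around the real number `a`. -/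
def powRemainder (p a : ℝ) (v : ℂ) : ℂ :=
  (↑(‖v + (a : ℂ)‖ ^ (p - 1)) : ℂ) * (v + (a : ℂ))
    - (↑(a ^ p) : ℂ)
    - (↑((p + 1) / 2 * a ^ (p - 1)) : ℂ) * v
    - (↑((p - 1) / 2 * a ^ (p - 1)) : ℂ) * (starRingEnd ℂ v)

lemma Rnl_eq (d : ℕ) (v : Euc d → ℂ) (x : Euc d) :
    Rnl d v x = -Complex.I * powRemainder (pc d) (Wgs d x) (v x) := rfl

lemma powRemainder_mul (p : ℝ) {a : ℝ} (ha : 0 < a) (v : ℂ) :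
    powRemainder p a (a * v) = (↑(a ^ p) : ℂ) * powRemainder p 1 v := by
  have h1 : ‖(a : ℂ) * v + a‖ = a * ‖v + 1‖ := by
    rw [show (a : ℂ) * v + a = a * (v + 1) by ring, norm_mul, Complex.norm_real,
      Real.norm_of_nonneg ha.le]
  have h2 : a ^ p = a ^ (p - 1) * a := by
    rw [Real.rpow_sub_one ha.ne']; field_simp
  simp only [powRemainder, h1, Real.mul_rpow ha.le (norm_nonneg _), h2, Complex.ofReal_one,
    Real.one_rpow, map_mul, Complex.conj_ofReal]
  push_cast
  ring

lemma contDiffAt_powRemainder_one (p : ℝ) {n : WithTop ℕ∞} {z : ℂ} (hz : z + 1 ≠ 0) :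
    ContDiffAt ℝ n (powRemainder p 1) z := by
  have h1 : ContDiffAt ℝ n (fun z : ℂ => z + ((1 : ℝ) : ℂ)) z := by fun_prop
  have h2 : ContDiffAt ℝ n (fun z : ℂ => ((‖z + ((1 : ℝ) : ℂ)‖ ^ (p - 1) : ℝ) : ℂ)) z :=
    Complex.ofRealCLM.contDiff.contDiffAt.comp z
      ((h1.norm ℝ (by simpa using hz)).rpow_const_of_ne (by simpa using hz))
  have h3 : ContDiffAt ℝ n (fun z : ℂ => starRingEnd ℂ z) z :=
    Complex.conjCLE.contDiff.contDiffAt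
  exact (((h2.mul h1).sub contDiffAt_const).sub (contDiffAt_const.mul contDiffAt_id)).sub
    (contDiffAt_const.mul h3)

lemma hasFDerivAt_powRemainder_one_zero (p : ℝ) :
    HasFDerivAt (powRemainder p 1) (0 : ℂ →L[ℝ] ℂ) 0 := by
  have h1 : HasFDerivAt (fun z : ℂ => z + ((1 : ℝ) : ℂ)) (ContinuousLinearMap.id ℝ ℂ) 0 :=
    (hasFDerivAt_id 0).add_const _
  have h2 := (h1.norm_sq).rpow_const (p := (p - 1) / 2) (Or.inl (by simp))
  have h3 := Complex.ofRealCLM.hasFDerivAt.comp (0 : ℂ) h2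
  have h4 : HasFDerivAt (fun z : ℂ => starRingEnd ℂ z) (Complex.conjCLE : ℂ →L[ℝ] ℂ) 0 :=
    Complex.conjCLE.hasFDerivAt
  have h5 := (h3.mul h1).sub_const (((1 : ℝ) ^ p : ℝ) : ℂ)
  have h6 := (hasFDerivAt_id (𝕜 := ℝ) (0 : ℂ)).const_mul (((p + 1) / 2 * 1 ^ (p - 1) : ℝ) : ℂ)
  have h7 := h4.const_mul (((p - 1) / 2 * 1 ^ (p - 1) : ℝ) : ℂ)
  have h8 := (h5.sub h6).sub h7
  have hfun : ∀ z : ℂ, (‖z + 1‖ ^ 2) ^ ((p - 1) / 2) = ‖z + 1‖ ^ (p - 1) := by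
    intro z
    rw [← Real.rpow_natCast, ← Real.rpow_mul (norm_nonneg _)]
    congr 1
    push_cast
    ring
  refine (h8.congr_fderiv ?_).congr_of_eventuallyEq (Filter.Eventually.of_forall fun z => ?_)
  · ext z
    apply Complex.ext <;> simp <;> ring
  · simp [powRemainder, hfun]

/-- On the ball of radius `3 / 4` the remainder has Lipschitz derivative, vanishing at `0`. -/
lemma exists_powRemainder_one_sub_le_of_small (p : ℝ) :
    ∃ L : ℝ, 0 ≤ L ∧ ∀ z y : ℂ, ‖z‖ + ‖y‖ ≤ 3 / 4 →
      ‖powRemainder p 1 (y + z) - powRemainder p 1 z‖ ≤ L * (‖z‖ + ‖y‖) * ‖y‖ := by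
  have hne : ∀ z ∈ Metric.closedBall (0 : ℂ) (3 / 4), z + 1 ≠ 0 := by
    intro z hz h
    rw [mem_closedBall_zero_iff, eq_neg_of_add_eq_zero_left h] at hz
    norm_num at hz
  have hcd : ContDiffOn ℝ 1 (fderiv ℝ (powRemainder p 1)) (Metric.closedBall 0 (3 / 4)) :=
    fun z hz => ((contDiffAt_powRemainder_one p (n := 2) (hne z hz)).fderiv_right
      (by norm_num)).contDiffWithinAt
  obtain ⟨K, hK⟩ := hcd.exists_lipschitzOnWith one_ne_zero (convex_closedBall _ _)
    (isCompact_closedBall _ _)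
  refine ⟨K, K.2, fun z y hzy => ?_⟩
  have hsub : Metric.closedBall (0 : ℂ) (‖z‖ + ‖y‖) ⊆ Metric.closedBall 0 (3 / 4) :=
    Metric.closedBall_subset_closedBall hzy
  have hmv := Convex.norm_image_sub_le_of_norm_fderiv_le (𝕜 := ℝ) (f := powRemainder p 1)
    (C := K * (‖z‖ + ‖y‖)) (s := Metric.closedBall (0 : ℂ) (‖z‖ + ‖y‖)) (x := z) (y := y + z)
    (fun x hx => (contDiffAt_powRemainder_one p (n := 1) (hne x (hsub hx))).differentiableAt
      one_ne_zero) (fun x hx => ?_) (convex_closedBall _ _) (by simp)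
    (by simpa [add_comm] using norm_add_le y z)
  · simpa using hmv
  · have h := hK.norm_sub_le (hsub hx) (Metric.mem_closedBall_self (by norm_num))
    rw [(hasFDerivAt_powRemainder_one_zero p).fderiv, sub_zero, sub_zero] at h
    exact h.trans (mul_le_mul_of_nonneg_left (by simpa using hx) K.2)

lemma powRemainder_one_sub_le_of_large {p : ℝ} (hp : 1 < p) (hp2 : p ≤ 2) {z y : ℂ}
    (hz : ‖z‖ ≤ 1 / 4) (hy : 1 / 2 ≤ ‖y‖) :
    ‖powRemainder p 1 (y + z) - powRemainder p 1 z‖ ≤ 40 * ‖y‖ ^ p := by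
  have hf : ∀ u : ℂ, ‖u‖ ≤ 4 * ‖y‖ → ‖((‖u‖ ^ (p - 1) : ℝ) : ℂ) * u‖ ≤ 16 * ‖y‖ ^ p := by
    intro u hu
    rw [norm_mul, Complex.norm_real, Real.norm_of_nonneg (by positivity)]
    calc ‖u‖ ^ (p - 1) * ‖u‖ ≤ (4 * ‖y‖) ^ (p - 1) * (4 * ‖y‖) := by gcongr
      _ = (4 * ‖y‖) ^ p := by
        rw [Real.rpow_sub_one (by linarith)]; field_simp
      _ = 4 ^ p * ‖y‖ ^ p := Real.mul_rpow (by norm_num) (norm_nonneg _)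
      _ ≤ 4 ^ (2 : ℝ) * ‖y‖ ^ p := by gcongr; norm_num
      _ = 16 * ‖y‖ ^ p := by norm_num
  have hlin : ‖y‖ ≤ 2 * ‖y‖ ^ p := by
    have : 2 * ‖y‖ ≤ 4 * ‖y‖ ^ p := by
      calc 2 * ‖y‖ ≤ (2 * ‖y‖) ^ p := Real.self_le_rpow_of_one_le (by linarith) hp.le
        _ = 2 ^ p * ‖y‖ ^ p := Real.mul_rpow (by norm_num) (norm_nonneg _)
        _ ≤ 2 ^ (2 : ℝ) * ‖y‖ ^ p := by gcongr; norm_num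
        _ = 4 * ‖y‖ ^ p := by norm_num
    linarith
  have e : powRemainder p 1 (y + z) - powRemainder p 1 z =
      ((‖y + z + 1‖ ^ (p - 1) : ℝ) : ℂ) * (y + z + 1) - ((‖z + 1‖ ^ (p - 1) : ℝ) : ℂ) * (z + 1)
      - (((p + 1) / 2 : ℝ) : ℂ) * y - (((p - 1) / 2 : ℝ) : ℂ) * starRingEnd ℂ y := by
    simp only [powRemainder, Real.one_rpow, map_add, Complex.ofReal_one, mul_one]
    ring
  have h1 := hf (y + z + 1) (by
    calc ‖y + z + 1‖ ≤ ‖y‖ + ‖z‖ + ‖(1 : ℂ)‖ := norm_add₃_le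
      _ ≤ 4 * ‖y‖ := by rw [norm_one]; linarith)
  have h2 := hf (z + 1) (by
    calc ‖z + 1‖ ≤ ‖z‖ + ‖(1 : ℂ)‖ := norm_add_le _ _
      _ ≤ 4 * ‖y‖ := by rw [norm_one]; linarith)
  have h3 : ‖(((p + 1) / 2 : ℝ) : ℂ) * y‖ = (p + 1) / 2 * ‖y‖ := by
    rw [norm_mul, Complex.norm_real, Real.norm_of_nonneg (by linarith)]
  have h4 : ‖(((p - 1) / 2 : ℝ) : ℂ) * starRingEnd ℂ y‖ = (p - 1) / 2 * ‖y‖ := by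
    rw [norm_mul, Complex.norm_real, Real.norm_of_nonneg (by linarith), RCLike.norm_conj]
  rw [e]
  refine (norm_sub_le _ _).trans ?_
  rw [h4]
  refine (add_le_add_left (norm_sub_le _ _) _).trans ?_
  rw [h3]
  refine (add_le_add_left (add_le_add_left (norm_sub_le _ _) _) _).trans ?_
  nlinarith [norm_nonneg y]

lemma exists_powRemainder_one_sub_le {p : ℝ} (hp : 1 < p) (hp2 : p ≤ 2) :
    ∃ C : ℝ, 0 < C ∧ ∀ z y : ℂ, ‖z‖ ≤ 1 / 4 →
      ‖powRemainder p 1 (y + z) - powRemainder p 1 z‖ ≤ C * (‖y‖ ^ p + ‖z‖ * ‖y‖) := by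
  obtain ⟨L, hL, h⟩ := exists_powRemainder_one_sub_le_of_small p
  refine ⟨L + 40, by linarith, fun z y hz => ?_⟩
  have hyp : 0 ≤ ‖y‖ ^ p := by positivity
  have hzy : 0 ≤ ‖z‖ * ‖y‖ := by positivity
  rcases le_total ‖y‖ (1 / 2) with hy | hy
  · have hsq : ‖y‖ * ‖y‖ ≤ ‖y‖ ^ p := by
      rw [← sq, ← Real.rpow_natCast]
      exact Real.rpow_le_rpow_of_exponent_ge' (norm_nonneg _) (by linarith) (by linarith)
        (by exact_mod_cast hp2)
    have := h z y (by linarith)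
    nlinarith
  · have := powRemainder_one_sub_le_of_large hp hp2 hz hy
    nlinarith [mul_nonneg hL hyp, mul_nonneg hL hzy]

lemma exists_powRemainder_sub_le {p : ℝ} (hp : 1 < p) (hp2 : p ≤ 2) :
    ∃ C : ℝ, 0 < C ∧ ∀ (a : ℝ) (w h : ℂ), 0 < a → ‖w‖ ≤ a / 4 →
      ‖powRemainder p a (h + w) - powRemainder p a w‖ ≤
        C * (‖h‖ ^ p + ‖((a⁻¹ : ℝ) : ℂ) * w‖ * (a ^ (p - 1) * ‖h‖)) := by
  obtain ⟨C, hC, hb⟩ := exists_powRemainder_one_sub_le hp hp2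
  refine ⟨C, hC, fun a w h ha hw => ?_⟩
  have ha' : (a : ℂ) ≠ 0 := by exact_mod_cast ha.ne'
  obtain ⟨z, rfl⟩ : ∃ z : ℂ, w = a * z := ⟨w / a, by field_simp⟩
  obtain ⟨y, rfl⟩ : ∃ y : ℂ, h = a * y := ⟨h / a, by field_simp⟩
  have hn : ∀ u : ℂ, ‖(a : ℂ) * u‖ = a * ‖u‖ := fun u => by
    rw [norm_mul, Complex.norm_real, Real.norm_of_nonneg ha.le]
  have hz : ‖z‖ ≤ 1 / 4 := by
    rw [hn] at hw
    exact le_of_mul_le_mul_left (by linarith) ha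
  rw [← mul_add, powRemainder_mul p ha, powRemainder_mul p ha, ← mul_sub, norm_mul,
    Complex.norm_real, Real.norm_of_nonneg (by positivity), Complex.ofReal_inv, inv_mul_cancel_left₀ ha', hn,
    Real.mul_rpow ha.le (norm_nonneg _)]
  calc a ^ p * ‖powRemainder p 1 (y + z) - powRemainder p 1 z‖
      ≤ a ^ p * (C * (‖y‖ ^ p + ‖z‖ * ‖y‖)) := by gcongr; exact hb z y hz
    _ = C * (a ^ p * ‖y‖ ^ p + ‖z‖ * (a ^ (p - 1) * (a * ‖y‖))) := by
      rw [Real.rpow_sub_one ha.ne']; field_simp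

lemma Wgs_pos {d : ℕ} (hd : 2 < d) (x : Euc d) : 0 < Wgs d x := by
  have hD : (2 : ℝ) < d := by exact_mod_cast hd
  have : 0 < (d : ℝ) - 2 := by linarith
  unfold Wgs
  positivity

lemma continuous_Wgs {d : ℕ} (hd : 2 < d) : Continuous (Wgs d) := by
  have hD : (2 : ℝ) < d := by exact_mod_cast hd
  have h2 : 0 < (d : ℝ) - 2 := by linarith
  unfold Wgs
  refine Continuous.rpow_const (by fun_prop) fun x => Or.inl ?_
  positivity

lemma memLp_Wgs_rpow {d : ℕ} (hd : 2 < d) :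
    MemLp (fun x => Wgs d x ^ (pc d - 1)) (ENNReal.ofReal ((d : ℝ) / 2)) volume := by
  have hD : (2 : ℝ) < d := by exact_mod_cast hd
  have h2 : 0 < (d : ℝ) - 2 := by linarith
  have hcont : Continuous fun x => Wgs d x ^ (pc d - 1) :=
    (continuous_Wgs hd).rpow_const fun x => Or.inl (Wgs_pos hd x).ne'
  rw [← integrable_norm_rpow_iff hcont.aestronglyMeasurable
    (by simp; linarith) ENNReal.ofReal_ne_top, ENNReal.toReal_ofReal (by linarith)]
  set c : ℝ := (d : ℝ) * ((d : ℝ) - 2) with hc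
  have hc1 : 1 ≤ c := by
    have h3 : (3 : ℝ) ≤ d := by exact_mod_cast hd
    nlinarith
  have hmajorant : Integrable (fun x : Euc d => c ^ (d : ℝ) * (1 + ‖x‖ ^ 2) ^ (-(2 * (d : ℝ)) / 2))
      volume :=
    (integrable_rpow_neg_one_add_norm_sq (by simp; linarith)).const_mul _
  refine hmajorant.mono' (by
    have := hcont.norm.rpow_const (p := (d : ℝ) / 2) fun x => Or.inr (by linarith)
    exact this.aestronglyMeasurable) (Filter.Eventually.of_forall fun x => ?_)
  have hW := Wgs_pos hd x
  rw [Real.norm_of_nonneg (by positivity), Real.norm_of_nonneg (by positivity), Wgs, ← hc,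
    ← Real.rpow_mul (by positivity), ← Real.rpow_mul (by positivity)]
  have he : -(((d : ℝ) - 2) / 2) * ((pc d - 1) * ((d : ℝ) / 2)) = -(d : ℝ) := by
    unfold pc; field_simp; ring
  rw [he, show -(2 * (d : ℝ)) / 2 = -(d : ℝ) by ring]
  have hle : (1 + ‖x‖ ^ 2) / c ≤ 1 + ‖x‖ ^ 2 / c := by
    rw [add_div]
    gcongr
    exact div_le_one_of_le₀ hc1 (by linarith)
  calc (1 + ‖x‖ ^ 2 / c) ^ (-(d : ℝ)) ≤ ((1 + ‖x‖ ^ 2) / c) ^ (-(d : ℝ)) :=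
        Real.rpow_le_rpow_of_nonpos (by positivity) hle (by linarith)
    _ = c ^ (d : ℝ) * (1 + ‖x‖ ^ 2) ^ (-(d : ℝ)) := by
      rw [Real.div_rpow (by positivity) (by positivity), Real.rpow_neg (x := c) (by positivity)]
      field_simp

/-- if |w| ≤ W/4 a.e. then
‖R(h+w) − R(w)‖_{L^{2d/(d+2)}} ≤ C(‖h‖_{L^{2d/(d−2)}}^{p_c} + ‖W^{−1}w‖_{L^∞}‖h‖_{L^{2d/(d−2)}}). -/
theorem R_difference_bound (d : ℕ) (hd : 6 ≤ d) :
    ∃ C : ℝ, 0 < C ∧ ∀ w h : Euc d → ℂ, Measurable w → Measurable h →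
      (∀ᵐ x ∂(volume : Measure (Euc d)), ‖w x‖ ≤ Wgs d x / 4) →
      eLpNorm (fun x => Rnl d (fun y => h y + w y) x - Rnl d w x)
          (ENNReal.ofReal (2 * (d : ℝ) / ((d : ℝ) + 2))) volume ≤
        ENNReal.ofReal C *
          ((eLpNorm h (ENNReal.ofReal (2 * (d : ℝ) / ((d : ℝ) - 2))) volume) ^ (pc d)
            + eLpNorm (fun x => (Wgs d x)⁻¹ * w x) ⊤ volume *
              eLpNorm h (ENNReal.ofReal (2 * (d : ℝ) / ((d : ℝ) - 2))) volume) := by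
  have hd2 : 2 < d := by omega
  have hD : (6 : ℝ) ≤ d := by exact_mod_cast hd
  have h2 : 0 < (d : ℝ) - 2 := by linarith
  have hp : 1 < pc d := by unfold pc; rw [one_lt_div h2]; linarith
  have hp2 : pc d ≤ 2 := by unfold pc; rw [div_le_iff₀ h2]; linarith
  obtain ⟨C, hC, hb⟩ := exists_powRemainder_sub_le hp hp2
  have hWL := memLp_Wgs_rpow hd2
  set S := eLpNorm (fun x => Wgs d x ^ (pc d - 1)) (ENNReal.ofReal ((d : ℝ) / 2)) volume with hS
  have hStop : S ≠ ⊤ := hWL.eLpNorm_ne_top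
  set q := ENNReal.ofReal (2 * (d : ℝ) / ((d : ℝ) + 2)) with hq
  set r := ENNReal.ofReal (2 * (d : ℝ) / ((d : ℝ) - 2)) with hr
  have hq1 : 1 ≤ q := by
    rw [hq, ENNReal.one_le_ofReal, one_le_div (by linarith)]
    linarith
  have hqr : q * ENNReal.ofReal (pc d) = r := by
    rw [hq, hr, ← ENNReal.ofReal_mul (by positivity)]
    congr 1
    unfold pc
    field_simp
  have : ENNReal.HolderTriple (ENNReal.ofReal ((d : ℝ) / 2)) r q := by
    constructor
    rw [hq, hr, ← ENNReal.ofReal_inv_of_pos (by positivity),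
      ← ENNReal.ofReal_inv_of_pos (by positivity), ← ENNReal.ofReal_inv_of_pos (by positivity),
      ← ENNReal.ofReal_add (by positivity) (by positivity)]
    congr 1
    field_simp
    ring
  refine ⟨C * (1 + S.toReal), by positivity, fun w h hw hh hwW => ?_⟩
  have hWm : Measurable (Wgs d) := (continuous_Wgs hd2).measurable
  set N : Euc d → ℝ := fun x => ‖((Wgs d x)⁻¹ : ℝ) * w x‖ with hN
  set g : Euc d → ℝ := fun x => Wgs d x ^ (pc d - 1) with hg
  set k : Euc d → ℝ := fun x => ‖h x‖ with hk
  have hNm : Measurable N := by fun_prop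
  have hgm : Measurable g := by fun_prop
  have hkm : Measurable k := by fun_prop
  have hkpm : Measurable fun x => k x ^ pc d := by fun_prop
  have hmain : eLpNorm (fun x => Rnl d (fun y => h y + w y) x - Rnl d w x) q volume ≤
      ENNReal.ofReal C * eLpNorm ((fun x => k x ^ pc d) + N • g • k) q volume := by
    refine eLpNorm_le_mul_eLpNorm_of_ae_le_mul ?_ q
    filter_upwards [hwW] with x hx
    rw [Rnl_eq, Rnl_eq, ← mul_sub, norm_mul, norm_neg, Complex.norm_I, one_mul]
    exact (hb _ _ _ (Wgs_pos hd2 x) hx).trans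
      (mul_le_mul_of_nonneg_left (le_abs_self _) hC.le)
  have hkp : eLpNorm (fun x => k x ^ pc d) q volume = eLpNorm h r volume ^ pc d := by
    rw [eLpNorm_norm_rpow h (by linarith), hqr]
  have hNgk : eLpNorm (N • g • k) q volume ≤
      eLpNorm (fun x => ((Wgs d x)⁻¹ : ℝ) * w x) ⊤ volume * (S * eLpNorm h r volume) := by
    refine (eLpNorm_smul_le_eLpNorm_top_mul_eLpNorm q
      (hgm.smul hkm).aestronglyMeasurable N).trans ?_
    rw [hN, eLpNorm_norm]
    gcongr
    refine (eLpNorm_smul_le_mul_eLpNorm hkm.aestronglyMeasurable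
      hgm.aestronglyMeasurable (p := ENNReal.ofReal ((d : ℝ) / 2)) (q := r)).trans ?_
    rw [hk, eLpNorm_norm]
  set H := eLpNorm h r volume
  set M := eLpNorm (fun x => ((Wgs d x)⁻¹ : ℝ) * w x) ⊤ volume
  rw [ENNReal.ofReal_mul hC.le, mul_assoc, ENNReal.ofReal_add zero_le_one ENNReal.toReal_nonneg,
    ENNReal.ofReal_one, ENNReal.ofReal_toReal hStop]
  refine hmain.trans ?_
  gcongr
  calc eLpNorm ((fun x => k x ^ pc d) + N • g • k) q volume
      ≤ H ^ pc d + M * (S * H) := by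
        refine (eLpNorm_add_le hkpm.aestronglyMeasurable
          (hNm.smul (hgm.smul hkm)).aestronglyMeasurable hq1).trans ?_
        rw [hkp]
        gcongr
    _ = H ^ pc d + S * (M * H) := by ring
    _ ≤ (1 + S) * H ^ pc d + (1 + S) * (M * H) := by
        gcongr
        · exact le_mul_of_one_le_left zero_le le_self_add
        · exact le_add_self
    _ = (1 + S) * (H ^ pc d + M * H) := by ring
end
end

section
/- Let d ≥ 1 and let k₁, k₂ ≥ 0 be integers. There exists a constant C = C(d, k₁, k₂) such that for every integer m ≥ k₁ + k₂ + d/2 + 1 and every Schwartz function f : ℝ^d → ℂ, one has sup_{x ∈ ℝ^d} ⟨x⟩^{k₁} |∇^{k₂} f(x)| ≤ C ‖f‖_{H^{m,m}}. -/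
open MeasureTheory
open scoped ENNReal

noncomputable section

/-- The weighted Sobolev norm ‖f‖_{H^{m,m}} = Σ_{j=0}^m ‖⟨x⟩^{m−j} ∇^j f‖_{L²}. -/
def HmmNorm (d m : ℕ) (f : Euc d → ℂ) : ℝ≥0∞ :=
  ∑ j ∈ Finset.range (m + 1),
    eLpNorm (fun x : Euc d =>
      (1 + ‖x‖ ^ 2) ^ (((m : ℝ) - (j : ℝ)) / 2) * ‖iteratedFDeriv ℝ j f x‖) 2 volume

open scoped LineDeriv SchwartzMap FourierTransform

theorem one_add_sum_pow_le {ι : Type*} [Fintype ι] (b : ι → ℝ) (hb : ∀ i, 0 ≤ b i) (s : ℕ) :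
    (1 + ∑ i, b i) ^ s ≤ (Fintype.card ι + 1 : ℝ) ^ s * (1 + ∑ i, b i ^ s) := by
  obtain ⟨M, hM1, hM, hMs⟩ : ∃ M : ℝ, 1 ≤ M ∧ (∀ i, b i ≤ M) ∧ M ^ s ≤ 1 + ∑ i, b i ^ s := by
    by_cases h : ∀ i, b i ≤ 1
    · refine ⟨1, le_rfl, h, ?_⟩
      rw [one_pow]
      exact le_add_of_nonneg_right (Finset.sum_nonneg fun i _ => pow_nonneg (hb i) s)
    · push Not at h
      obtain ⟨i₀, hi₀⟩ := h
      obtain ⟨i, -, hi⟩ := Finset.exists_max_image Finset.univ b ⟨i₀, Finset.mem_univ _⟩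
      refine ⟨b i, hi₀.le.trans (hi i₀ (Finset.mem_univ _)), fun j => hi j (Finset.mem_univ _), ?_⟩
      have := Finset.single_le_sum (f := fun i => b i ^ s) (fun i _ => pow_nonneg (hb i) s)
        (Finset.mem_univ i)
      linarith
  have hsum : ∑ i, b i ≤ Fintype.card ι * M := by
    simpa using Finset.sum_le_card_nsmul Finset.univ b M fun i _ => hM i
  calc (1 + ∑ i, b i) ^ s ≤ ((Fintype.card ι + 1 : ℝ) * M) ^ s := by
        have := Finset.sum_nonneg fun i (_ : i ∈ Finset.univ) => hb i
        gcongr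
        linarith
    _ ≤ _ := by
        rw [mul_pow]
        gcongr

theorem one_add_norm_pow_le_sum (d s : ℕ) (ξ : Euc d) :
    (1 + ‖ξ‖) ^ s ≤ (d + 1 : ℝ) ^ s * (1 + ∑ i, |ξ i| ^ s) := by
  have hξ : ‖ξ‖ ≤ ∑ i, |ξ i| := by
    rw [EuclideanSpace.norm_eq]
    refine Real.sqrt_le_iff.2 ⟨by positivity, ?_⟩
    simpa using Finset.sum_sq_le_sq_sum_of_nonneg (s := Finset.univ) (f := fun i => |ξ i|)
      fun i _ => abs_nonneg _
  calc (1 + ‖ξ‖) ^ s ≤ (1 + ∑ i, |ξ i|) ^ s := by gcongr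
    _ ≤ _ := by simpa using one_add_sum_pow_le (fun i => |ξ i|) (fun i => abs_nonneg _) s

theorem norm_iteratedFDeriv_lineDeriv_le {d : ℕ} (f : 𝓢(Euc d, ℂ)) (v : Euc d) (j : ℕ)
    (x : Euc d) : ‖iteratedFDeriv ℝ j (∂_{v} f : 𝓢(Euc d, ℂ)) x‖ ≤ ‖v‖ * ‖iteratedFDeriv ℝ (j + 1) f x‖ := by
  have h : ⇑(∂_{v} f : 𝓢(Euc d, ℂ)) = (ContinuousLinearMap.apply ℝ ℂ v) ∘ fderiv ℝ f := by
    ext y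
    simp [SchwartzMap.lineDerivOp_apply_eq_fderiv]
  rw [h, ← norm_iteratedFDeriv_fderiv]
  have hf : ContDiff ℝ ((⊤ : ℕ∞) : WithTop ℕ∞) (fderiv ℝ f) := (f.smooth ⊤).fderiv_right le_rfl
  refine (ContinuousLinearMap.norm_iteratedFDeriv_comp_left _ (hf.contDiffAt)
    (mod_cast le_top : ((j : ℕ∞) : WithTop ℕ∞) ≤ _)).trans ?_
  gcongr
  exact ContinuousLinearMap.opNorm_le_bound _ (norm_nonneg _) fun A => by
    simpa [mul_comm] using A.le_opNorm v

theorem norm_iteratedFDeriv_iteratedLineDeriv_le {d n : ℕ} (f : 𝓢(Euc d, ℂ))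
    (v : Fin n → Euc d) (j : ℕ) (x : Euc d) :
    ‖iteratedFDeriv ℝ j (∂^{v} f : 𝓢(Euc d, ℂ)) x‖ ≤ (∏ i, ‖v i‖) * ‖iteratedFDeriv ℝ (j + n) f x‖ := by
  induction n generalizing j with
  | zero => simp
  | succ n ih =>
    rw [LineDeriv.iteratedLineDerivOp_succ_left, Fin.prod_univ_succ, mul_assoc]
    refine (norm_iteratedFDeriv_lineDeriv_le _ _ _ _).trans ?_
    gcongr
    rw [show j + (n + 1) = j + 1 + n by ring]
    exact ih _ _

theorem norm_fourier_iteratedLineDeriv_const {d : ℕ} (f : 𝓢(Euc d, ℂ)) (v : Euc d) (n : ℕ)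
    (ξ : Euc d) : ‖𝓕 (∂^{fun _ : Fin n => v} f) ξ‖ =
      (2 * Real.pi * |inner ℝ ξ v|) ^ n * ‖𝓕 f ξ‖ := by
  induction n with
  | zero => simp
  | succ n ih =>
    have : (inner ℝ · v : Euc d → ℝ).HasTemperateGrowth := by fun_prop
    rw [LineDeriv.iteratedLineDerivOp_succ_left, SchwartzMap.fourier_lineDerivOp_eq]
    simp only [_root_.smul_apply, SchwartzMap.smulLeftCLM_apply_apply this, norm_smul]
    rw [show (Fin.tail fun _ : Fin (n + 1) => v) = fun _ : Fin n => v from rfl, ih]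
    simp [abs_of_pos Real.pi_pos]
    ring

theorem eLpNorm_fourier_two {d : ℕ} (f : 𝓢(Euc d, ℂ)) :
    eLpNorm (𝓕 f : 𝓢(Euc d, ℂ)) 2 volume = eLpNorm f 2 volume := by
  have h := SchwartzMap.norm_fourier_toL2_eq f
  rw [SchwartzMap.norm_toLp, SchwartzMap.norm_toLp] at h
  exact (ENNReal.toReal_eq_toReal_iff' ((𝓕 f).memLp 2 volume).eLpNorm_ne_top
    (f.memLp 2 volume).eLpNorm_ne_top).1 h

theorem enorm_apply_le_eLpNorm_fourier_one {d : ℕ} (f : 𝓢(Euc d, ℂ)) (x : Euc d) :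
    ‖f x‖ₑ ≤ eLpNorm (𝓕 f : 𝓢(Euc d, ℂ)) 1 volume := by
  have h : f x = ∫ v, Real.fourierChar (inner ℝ v x) • 𝓕 f v := by
    conv_lhs => rw [← FourierTransform.fourierInv_fourier_eq (F := 𝓢(Euc d, ℂ)) f]
    rw [SchwartzMap.fourierInv_coe, Real.fourierInv_eq]
  rw [h, eLpNorm_one_eq_lintegral_enorm]
  refine (enorm_integral_le_lintegral_enorm _).trans_eq (lintegral_congr fun v => ?_)
  rw [enorm_eq_iff_norm_eq]
  exact Circle.norm_smul _ _

theorem exists_enorm_le_sum_eLpNorm (d s : ℕ) (hs : (d : ℝ) < 2 * s) :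
    ∃ C : ℝ≥0∞, C ≠ ⊤ ∧ ∀ (f : 𝓢(Euc d, ℂ)) (x : Euc d),
      ‖f x‖ₑ ≤ C * ∑ j ∈ Finset.range (s + 1), eLpNorm (iteratedFDeriv ℝ j f) 2 volume := by
  set w : Euc d → ℝ := fun ξ => ((1 + ‖ξ‖) ^ s)⁻¹ with hw
  have hwm : MemLp w 2 volume := by
    have hmeas : AEStronglyMeasurable w volume :=
      (by fun_prop : Measurable w).aestronglyMeasurable
    rw [memLp_two_iff_integrable_sq hmeas]
    refine (integrable_one_add_norm (E := Euc d) (r := 2 * s) (by simpa using hs)).congr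
      (Filter.Eventually.of_forall fun ξ => ?_)
    have : 0 < 1 + ‖ξ‖ := by positivity
    simp only [hw]
    rw [Real.rpow_neg this.le, inv_pow, ← pow_mul, mul_comm s 2, ← Real.rpow_natCast]
    push_cast
    rfl
  set e : Fin d → Euc d := fun i => EuclideanSpace.single i 1 with he
  refine ⟨eLpNorm w 2 volume * ((d + 1) ^ s * (d + 1)), ?_, fun f x => ?_⟩
  · exact ENNReal.mul_ne_top hwm.eLpNorm_ne_top (by finiteness)
  set F : 𝓢(Euc d, ℂ) := 𝓕 f with hF
  set G : Fin d → 𝓢(Euc d, ℂ) := fun i => 𝓕 (∂^{fun _ : Fin s => e i} f : 𝓢(Euc d, ℂ)) with hG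
  set S := ∑ j ∈ Finset.range (s + 1), eLpNorm (iteratedFDeriv ℝ j f) 2 volume with hS
  have hGξ (i : Fin d) (ξ : Euc d) : |ξ i| ^ s * ‖F ξ‖ ≤ ‖G i ξ‖ := by
    rw [hG, norm_fourier_iteratedLineDeriv_const]
    have : inner ℝ ξ (e i) = ξ i := by simp [he, EuclideanSpace.inner_single_right]
    rw [this]
    gcongr
    have := Real.pi_gt_three
    nlinarith [abs_nonneg (ξ i)]
  have hpt (ξ : Euc d) : ‖F ξ‖ₑ ≤ ‖(w • fun ξ => (d + 1 : ℝ) ^ s * (‖F ξ‖ + ∑ i, ‖G i ξ‖)) ξ‖ₑ := by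
    rw [enorm_le_iff_norm_le]
    refine le_trans ?_ (le_abs_self _)
    have h1 : 0 < (1 + ‖ξ‖) ^ s := by positivity
    simp only [hw, Pi.smul_apply', smul_eq_mul]
    rw [inv_mul_eq_div, le_div_iff₀ h1]
    calc ‖F ξ‖ * (1 + ‖ξ‖) ^ s
        ≤ ‖F ξ‖ * ((d + 1 : ℝ) ^ s * (1 + ∑ i, |ξ i| ^ s)) := by
          gcongr
          exact one_add_norm_pow_le_sum d s ξ
      _ = (d + 1 : ℝ) ^ s * (‖F ξ‖ + ∑ i, |ξ i| ^ s * ‖F ξ‖) := by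
          rw [← Finset.sum_mul]
          ring
      _ ≤ _ := by
          gcongr with i
          exact hGξ i ξ
  have hFS : eLpNorm F 2 volume ≤ S := by
    rw [hF, eLpNorm_fourier_two]
    refine le_trans (le_of_eq ?_) (Finset.single_le_sum
      (f := fun j => eLpNorm (iteratedFDeriv ℝ j f) 2 volume) (fun _ _ => zero_le)
      (Finset.mem_range.2 (Nat.succ_pos s)))
    exact eLpNorm_congr_norm_ae (Filter.Eventually.of_forall fun y => by simp)
  have hGS (i : Fin d) : eLpNorm (G i) 2 volume ≤ S := by
    rw [hG, eLpNorm_fourier_two]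
    refine le_trans (eLpNorm_mono fun y => ?_) (Finset.single_le_sum
      (f := fun j => eLpNorm (iteratedFDeriv ℝ j f) 2 volume) (fun _ _ => zero_le)
      (Finset.mem_range.2 (Nat.lt_succ_self s)))
    have := norm_iteratedFDeriv_iteratedLineDeriv_le f (fun _ : Fin s => e i) 0 y
    rw [zero_add] at this
    simpa [he] using this
  calc ‖f x‖ₑ ≤ eLpNorm F 1 volume := enorm_apply_le_eLpNorm_fourier_one f x
    _ ≤ eLpNorm (w • fun ξ => (d + 1 : ℝ) ^ s * (‖F ξ‖ + ∑ i, ‖G i ξ‖)) 1 volume :=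
        eLpNorm_mono_enorm hpt
    _ ≤ eLpNorm w 2 volume *
          eLpNorm (fun ξ => (d + 1 : ℝ) ^ s * (‖F ξ‖ + ∑ i, ‖G i ξ‖)) 2 volume :=
        eLpNorm_smul_le_mul_eLpNorm (Continuous.aestronglyMeasurable (by fun_prop))
          hwm.aestronglyMeasurable
    _ ≤ eLpNorm w 2 volume * ((d + 1) ^ s * ((d + 1) * S)) := by
        gcongr
        have h2 : eLpNorm (fun ξ => (d + 1 : ℝ) ^ s * (‖F ξ‖ + ∑ i, ‖G i ξ‖)) 2 volume =
            (d + 1) ^ s * eLpNorm (fun ξ => ‖F ξ‖ + ∑ i, ‖G i ξ‖) 2 volume := by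
          have := eLpNorm_const_smul ((d + 1 : ℝ) ^ s) (fun ξ => ‖F ξ‖ + ∑ i, ‖G i ξ‖) 2
            (volume : Measure (Euc d))
          refine this.trans ?_
          congr 1
          rw [enorm_pow, ← ofReal_norm, Real.norm_of_nonneg (by positivity),
            ENNReal.ofReal_add (by positivity) zero_le_one]
          simp
        rw [h2]
        gcongr
        calc _ ≤ eLpNorm (fun ξ => ‖F ξ‖) 2 volume + eLpNorm (∑ i, fun ξ => ‖G i ξ‖) 2 volume := by
              refine le_trans (le_of_eq ?_) (eLpNorm_add_le
                (Continuous.aestronglyMeasurable (by fun_prop))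
                (Finset.aestronglyMeasurable_sum _ fun i _ =>
                  Continuous.aestronglyMeasurable (by fun_prop)) one_le_two)
              congr 1
              ext ξ
              simp
          _ ≤ S + ∑ i : Fin d, S := by
              refine add_le_add (by rwa [eLpNorm_norm]) ?_
              refine (eLpNorm_sum_le (fun i _ =>
                Continuous.aestronglyMeasurable (by fun_prop)) one_le_two).trans ?_
              gcongr with i
              rw [eLpNorm_norm]
              exact hGS i
          _ = (d + 1) * S := by
              simp
              ring
    _ = _ := by ring

theorem exists_enorm_le_sum_eLpNorm_indicator (d s : ℕ) (hs : (d : ℝ) < 2 * s) :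
    ∃ C : ℝ≥0∞, C ≠ ⊤ ∧ ∀ (g : 𝓢(Euc d, ℂ)) (x : Euc d), ‖g x‖ₑ ≤
      C * ∑ j ∈ Finset.range (s + 1),
        eLpNorm ((Metric.closedBall x 1).indicator (iteratedFDeriv ℝ j g)) 2 volume := by
  obtain ⟨C, hC, hsob⟩ := exists_enorm_le_sum_eLpNorm d s hs
  let χ : ContDiffBump (0 : Euc d) := ⟨1 / 2, 1, by norm_num, by norm_num⟩
  let χS : 𝓢(Euc d, ℝ) := χ.hasCompactSupport.toSchwartzMap χ.contDiff
  set K := ∑ i ∈ Finset.range (s + 1), SchwartzMap.seminorm ℝ 0 i χS with hK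
  have hK0 : 0 ≤ K := Finset.sum_nonneg fun i _ => apply_nonneg _ _
  set M : ℝ := (s + 1) * (2 ^ s * K) with hM
  have hM0 : 0 ≤ M := by positivity
  refine ⟨C * ((s + 1) * ENNReal.ofReal M), by finiteness, fun g x => ?_⟩
  set X : ℕ → Euc d → ℝ := fun j y =>
    ‖(Metric.closedBall x 1).indicator (iteratedFDeriv ℝ j g) y‖ with hX
  have hX0 (j : ℕ) (y : Euc d) : 0 ≤ X j y := norm_nonneg _
  have hXm (j : ℕ) : AEStronglyMeasurable (X j) volume :=
    (((g.smooth j).continuous_iteratedFDeriv le_rfl).aestronglyMeasurable.indicator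
      Metric.isClosed_closedBall.measurableSet).norm
  have hcd : ContDiff ℝ ((⊤ : ℕ∞) : WithTop ℕ∞) fun y => χ (y + -x) :=
    χ.contDiff.comp (contDiff_id.add contDiff_const)
  have hcs : HasCompactSupport fun y => χ (y + -x) :=
    χ.hasCompactSupport.comp_homeomorph (Homeomorph.addRight (-x))
  let h : 𝓢(Euc d, ℂ) := (hcs.smul_right (f' := g)).toSchwartzMap (hcd.smul (g.smooth ⊤))
  have hh (y : Euc d) : h y = χ (y + -x) • g y := rfl
  have hχ (i : ℕ) (hi : i ≤ s) (l : ℕ) (y : Euc d) :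
      ‖iteratedFDeriv ℝ i (fun y => χ (y + -x)) y‖ * ‖iteratedFDeriv ℝ l g y‖ ≤ K * X l y := by
    rw [iteratedFDeriv_comp_add_right]
    by_cases hy : y ∈ Metric.closedBall x 1
    · simp only [hX, Set.indicator_of_mem hy]
      gcongr
      refine (SchwartzMap.norm_iteratedFDeriv_le_seminorm ℝ χS i _).trans ?_
      exact Finset.single_le_sum (f := fun i => SchwartzMap.seminorm ℝ 0 i χS)
        (fun i _ => apply_nonneg _ _) (Finset.mem_range.2 (Nat.lt_succ_of_le hi))
    · have : iteratedFDeriv ℝ i χ (y + -x) = 0 := by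
        by_contra hne
        have := support_iteratedFDeriv_subset (𝕜 := ℝ) (f := χ) i hne
        rw [χ.tsupport_eq] at this
        apply hy
        simpa [χ, dist_eq_norm, sub_eq_add_neg] using this
      rw [this, norm_zero, zero_mul]
      exact mul_nonneg hK0 (hX0 _ _)
  have hpt (j : ℕ) (hj : j ∈ Finset.range (s + 1)) (y : Euc d) :
      ‖iteratedFDeriv ℝ j h y‖ ≤ M * ‖∑ l ∈ Finset.range (s + 1), X l y‖ := by
    rw [Real.norm_of_nonneg (Finset.sum_nonneg fun l _ => hX0 l y)]
    have hjs : j ≤ s := Nat.lt_succ_iff.1 (Finset.mem_range.1 hj)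
    have hle := norm_iteratedFDeriv_smul_le (n := j) hcd (g.smooth ⊤) y (mod_cast le_top)
    refine hle.trans ?_
    set T := ∑ l ∈ Finset.range (s + 1), X l y with hT
    have hT0 : 0 ≤ T := Finset.sum_nonneg fun l _ => hX0 l y
    calc _ ≤ ∑ i ∈ Finset.range (j + 1), 2 ^ s * K * T := by
          refine Finset.sum_le_sum fun i hi => ?_
          have hij : i ≤ j := Nat.lt_succ_iff.1 (Finset.mem_range.1 hi)
          rw [mul_assoc, mul_assoc]
          have hchoose : (j.choose i : ℝ) ≤ 2 ^ s := by
            exact_mod_cast (Nat.choose_le_two_pow j i).trans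
              (Nat.pow_le_pow_right two_pos hjs)
          refine mul_le_mul hchoose ?_ (by positivity) (by positivity)
          refine (hχ i (hij.trans hjs) (j - i) y).trans ?_
          gcongr
          exact Finset.single_le_sum (f := fun l => X l y) (fun l _ => hX0 l y)
            (Finset.mem_range.2 (by omega))
      _ = (j + 1) * (2 ^ s * K * T) := by simp
      _ ≤ (s + 1) * (2 ^ s * K * T) := by gcongr
      _ = M * T := by
          rw [hM]
          ring
  set S := ∑ j ∈ Finset.range (s + 1),
    eLpNorm ((Metric.closedBall x 1).indicator (iteratedFDeriv ℝ j g)) 2 volume with hS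
  have hgx : ‖g x‖ₑ = ‖h x‖ₑ := by
    have : χ (0 : Euc d) = 1 := χ.one_of_mem_closedBall (by simp [χ])
    rw [hh, add_neg_cancel, this, one_smul]
  have hXS : eLpNorm (fun y => ∑ l ∈ Finset.range (s + 1), X l y) 2 volume ≤ S := by
    have := eLpNorm_sum_le (p := 2) (s := Finset.range (s + 1)) (fun l _ => hXm l) one_le_two
    convert this using 1
    · congr 1
      ext y
      simp
    · exact Finset.sum_congr rfl fun l _ => (eLpNorm_norm _).symm
  calc ‖g x‖ₑ ≤ C * ∑ j ∈ Finset.range (s + 1), eLpNorm (iteratedFDeriv ℝ j h) 2 volume :=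
        hgx.trans_le (hsob h x)
    _ ≤ C * ∑ j ∈ Finset.range (s + 1), ENNReal.ofReal M * S := by
        gcongr with j hj
        refine (eLpNorm_le_mul_eLpNorm_of_ae_le_mul
          (Filter.Eventually.of_forall (hpt j hj)) 2).trans ?_
        gcongr
    _ = _ := by
        simp
        ring

theorem one_add_norm_sq_rpow_le_of_mem_closedBall {E : Type*} [SeminormedAddCommGroup E]
    {x y : E} (hy : y ∈ Metric.closedBall x 1) {a b : ℝ} (ha : 0 ≤ a) (hab : a ≤ b) :
    (1 + ‖x‖ ^ 2) ^ a ≤ 3 ^ a * (1 + ‖y‖ ^ 2) ^ b := by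
  have hxy : ‖x‖ ≤ ‖y‖ + 1 := by
    have h1 := norm_le_norm_add_norm_sub y x
    rw [Metric.mem_closedBall, dist_eq_norm] at hy
    linarith
  have h2 : 1 + ‖x‖ ^ 2 ≤ 3 * (1 + ‖y‖ ^ 2) := by
    nlinarith [norm_nonneg x, norm_nonneg y, sq_nonneg (‖y‖ - 1)]
  calc (1 + ‖x‖ ^ 2) ^ a ≤ (3 * (1 + ‖y‖ ^ 2)) ^ a := by gcongr
    _ = 3 ^ a * (1 + ‖y‖ ^ 2) ^ a := Real.mul_rpow (by norm_num) (by positivity)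
    _ ≤ _ := by
        gcongr
        nlinarith [sq_nonneg ‖y‖]

theorem eLpNorm_indicator_iteratedFDeriv_le_HmmNorm {d k₁ k₂ m j : ℕ} (h : k₁ + k₂ + j ≤ m)
    (f : 𝓢(Euc d, ℂ)) (v : Fin k₂ → Euc d) (x : Euc d) :
    eLpNorm ((Metric.closedBall x 1).indicator
        (iteratedFDeriv ℝ j (∂^{v} f : 𝓢(Euc d, ℂ)))) 2 volume ≤
      ENNReal.ofReal (3 ^ ((k₁ : ℝ) / 2) * (∏ i, ‖v i‖) / (1 + ‖x‖ ^ 2) ^ ((k₁ : ℝ) / 2)) *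
        HmmNorm d m f := by
  have hle := Finset.single_le_sum (f := fun j : ℕ => eLpNorm (fun x : Euc d =>
      (1 + ‖x‖ ^ 2) ^ (((m : ℝ) - (j : ℝ)) / 2) * ‖iteratedFDeriv ℝ j f x‖) 2 volume)
    (fun _ _ => zero_le) (Finset.mem_range.2 (by omega : j + k₂ < m + 1))
  refine le_trans ?_ (mul_le_mul_right hle _)
  refine eLpNorm_le_mul_eLpNorm_of_ae_le_mul (Filter.Eventually.of_forall fun y => ?_) 2
  by_cases hy : y ∈ Metric.closedBall x 1
  · rw [Set.indicator_of_mem hy, Real.norm_of_nonneg (by positivity), div_mul_eq_mul_div,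
      le_div_iff₀ (by positivity)]
    have h' : (k₁ : ℝ) + k₂ + j ≤ m := by exact_mod_cast h
    calc _ ≤ ((∏ i, ‖v i‖) * ‖iteratedFDeriv ℝ (j + k₂) f y‖) *
          (3 ^ ((k₁ : ℝ) / 2) * (1 + ‖y‖ ^ 2) ^ (((m : ℝ) - ((j + k₂ : ℕ) : ℝ)) / 2)) := by
          gcongr
          · exact norm_iteratedFDeriv_iteratedLineDeriv_le f v j y
          · refine one_add_norm_sq_rpow_le_of_mem_closedBall hy (by positivity) ?_
            push_cast
            linarith
      _ = _ := by ring
  · rw [Set.indicator_of_notMem hy, norm_zero]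
    positivity

/-- weighted Sobolev embedding: for m ≥ k₁ + k₂ + d/2 + 1,
sup_x ⟨x⟩^{k₁} |∇^{k₂} f(x)| ≤ C ‖f‖_{H^{m,m}}. -/
theorem Hmm_embedding (d k₁ k₂ : ℕ) (hd : 1 ≤ d) :
    ∃ C : ℝ, 0 < C ∧ ∀ m : ℕ,
      (k₁ : ℝ) + (k₂ : ℝ) + (d : ℝ) / 2 + 1 ≤ (m : ℝ) →
      ∀ f : SchwartzMap (Euc d) ℂ, ∀ x : Euc d,
        ENNReal.ofReal
            ((1 + ‖x‖ ^ 2) ^ ((k₁ : ℝ) / 2) * ‖iteratedFDeriv ℝ k₂ (⇑f) x‖) ≤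
          ENNReal.ofReal C * HmmNorm d m (⇑f) := by
  set s := d / 2 + 1 with hs
  have hds : (d : ℝ) < 2 * s := by exact_mod_cast (by omega : d < 2 * s)
  have hsd : (s : ℝ) ≤ d / 2 + 1 := by
    have : (2 * s : ℝ) ≤ d + 2 := by exact_mod_cast (by omega : 2 * s ≤ d + 2)
    linarith
  obtain ⟨C, hC, hloc⟩ := exists_enorm_le_sum_eLpNorm_indicator d s hds
  set A : ℝ := C.toReal * ((s + 1) * 3 ^ ((k₁ : ℝ) / 2)) with hA
  have hA0 : 0 ≤ A := by positivity
  refine ⟨A + 1, by positivity, fun m hm f x => ?_⟩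
  have hmN : k₁ + k₂ + s ≤ m := by
    have : (k₁ : ℝ) + k₂ + s ≤ m := by linarith
    exact_mod_cast this
  set W := (1 + ‖x‖ ^ 2) ^ ((k₁ : ℝ) / 2) with hW
  have hW0 : 0 < W := by positivity
  rcases eq_or_ne (HmmNorm d m f) ⊤ with htop | htop
  · rw [htop, ENNReal.mul_top (by simpa using by positivity)]
    exact le_top
  set N := (HmmNorm d m f).toReal with hN
  have hv (v : Fin k₂ → Euc d) : ‖iteratedFDeriv ℝ k₂ f x v‖ ≤ A * N / W * ∏ i, ‖v i‖ := by
    have hsum : ‖iteratedFDeriv ℝ k₂ f x v‖ₑ ≤ C * ∑ j ∈ Finset.range (s + 1),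
        ENNReal.ofReal (3 ^ ((k₁ : ℝ) / 2) * (∏ i, ‖v i‖) / W) * HmmNorm d m f := by
      rw [← SchwartzMap.iteratedLineDerivOp_eq_iteratedFDeriv]
      refine (hloc _ x).trans ?_
      gcongr with j hj
      have := Finset.mem_range.1 hj
      exact eLpNorm_indicator_iteratedFDeriv_le_HmmNorm (by omega) f v x
    have hreal := ENNReal.toReal_mono (ENNReal.mul_ne_top hC
      (ENNReal.sum_ne_top.2 fun _ _ => ENNReal.mul_ne_top ENNReal.ofReal_ne_top htop)) hsum
    rw [toReal_enorm] at hreal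
    refine hreal.trans_eq ?_
    simp only [Finset.sum_const, Finset.card_range, nsmul_eq_mul, ENNReal.toReal_mul]
    rw [ENNReal.toReal_ofReal (by positivity), ENNReal.toReal_natCast, ← hN, hA]
    push_cast
    ring
  have hop := ContinuousMultilinearMap.opNorm_le_bound (by positivity) hv
  rw [← ENNReal.ofReal_toReal htop, ← hN, ← ENNReal.ofReal_mul (by positivity)]
  refine ENNReal.ofReal_le_ofReal ?_
  have hN0 : 0 ≤ N := ENNReal.toReal_nonneg
  calc W * ‖iteratedFDeriv ℝ k₂ f x‖ ≤ W * (A * N / W) := by gcongr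
    _ = A * N := by field_simp
    _ ≤ (A + 1) * N := by nlinarith
end
end

section
/- Let d ≥ 1 and let m be a nonnegative integer. There exists a constant K = K(m,d) such that for every real C > 0, every integer j ≥ 2 with m ≥ d/2 + 1 + Cj/(j−1), and every Schwartz function h : ℝ^d → ℂ, one has ‖⟨x⟩^{Cj} h^j‖_{H^{m,m}} ≤ K j^m ‖h‖_{H^{m,m}}^j. -/
open MeasureTheory
open scoped ENNReal

noncomputable section

section

open SchwartzMap Set Filter Topology LineDeriv

theorem hasDerivAt_pow_div_factorial_mul_exp_neg (b : ℕ) (r : ℝ) :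
    HasDerivAt (fun r : ℝ => r ^ (b + 1) / (b + 1).factorial * Real.exp (-r))
      (r ^ b / b.factorial * Real.exp (-r) -
        r ^ (b + 1) / (b + 1).factorial * Real.exp (-r)) r := by
  have h1 : HasDerivAt (fun r : ℝ => r ^ (b + 1) / (b + 1).factorial)
      (r ^ b / b.factorial) r := by
    refine ((hasDerivAt_pow (b + 1) r).div_const ((b + 1).factorial : ℝ)).congr_deriv ?_
    rw [Nat.factorial_succ]
    push_cast
    field_simp
  have h2 : HasDerivAt (fun r : ℝ => Real.exp (-r)) (-Real.exp (-r)) r := by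
    simpa using (hasDerivAt_neg r).exp
  refine (h1.fun_mul h2).congr_deriv ?_
  ring

theorem integrableOn_pow_exp_neg_smul (b : ℕ) (f : 𝓢(ℝ, ℂ)) :
    IntegrableOn (fun r : ℝ => (r ^ b / b.factorial * Real.exp (-r)) • f r) (Ioi 0) := by
  refine ((f.integrable_pow_mul volume b).div_const (b.factorial : ℝ)).integrableOn.mono' ?_ ?_
  · have hc : Continuous fun r : ℝ => r ^ b / b.factorial * Real.exp (-r) := by fun_prop
    exact (hc.smul f.continuous).aestronglyMeasurable
  · filter_upwards [ae_restrict_mem measurableSet_Ioi] with r hr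
    have hr : 0 < r := hr
    rw [norm_smul, Real.norm_of_nonneg (by positivity), Real.norm_of_nonneg hr.le]
    have : Real.exp (-r) ≤ 1 := by simp [hr.le]
    calc r ^ b / b.factorial * Real.exp (-r) * ‖f r‖ ≤ r ^ b / b.factorial * 1 * ‖f r‖ := by gcongr
      _ = _ := by ring

theorem tendsto_pow_exp_neg_smul (b : ℕ) (f : 𝓢(ℝ, ℂ)) :
    Tendsto (fun r : ℝ => (r ^ b / b.factorial * Real.exp (-r)) • f r) atTop (𝓝 0) := by
  have h1 : Tendsto (fun r : ℝ => r ^ b / b.factorial * Real.exp (-r)) atTop (𝓝 0) := by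
    have := (Real.tendsto_pow_mul_exp_neg_atTop_nhds_zero b).div_const (b.factorial : ℝ)
    simp only [zero_div] at this
    exact this.congr fun r => by ring
  refine h1.zero_smul_isBoundedUnder_le ?_
  obtain ⟨C, hC⟩ := f.decay 0 0
  exact ⟨C, eventually_map.2 (Eventually.of_forall fun r => by simpa using hC.2 r)⟩

/-- The operator sending a Schwartz function of one variable to itself minus its derivative. -/
def subDeriv (f : 𝓢(ℝ, ℂ)) : 𝓢(ℝ, ℂ) := f - derivCLM ℝ ℂ f

theorem subDeriv_apply (f : 𝓢(ℝ, ℂ)) (r : ℝ) : subDeriv f r = f r - deriv f r := rfl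

theorem apply_zero_eq_integral_pow_exp_neg (b : ℕ) (f : 𝓢(ℝ, ℂ)) :
    f 0 = ∫ r in Ioi (0 : ℝ), (r ^ b / b.factorial * Real.exp (-r)) • (subDeriv^[b + 1] f) r := by
  induction b generalizing f with
  | zero =>
    have hd (r : ℝ) : HasDerivAt (fun r : ℝ => Real.exp (-r) • f r)
        (-((r ^ 0 / (Nat.factorial 0) * Real.exp (-r)) • (subDeriv f) r)) r := by
      have h2 : HasDerivAt (fun r : ℝ => Real.exp (-r)) (-Real.exp (-r)) r := by
        simpa using (hasDerivAt_neg r).exp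
      refine (h2.fun_smul (f.hasDerivAt r)).congr_deriv ?_
      simp [subDeriv_apply]
      ring
    have := integral_Ioi_of_hasDerivAt_of_tendsto' (a := 0) (m := 0) (fun r _ => hd r)
      (integrableOn_pow_exp_neg_smul 0 _).neg
      (by simpa using tendsto_pow_exp_neg_smul 0 f)
    rw [integral_neg] at this
    simpa using this.symm
  | succ b ih =>
    rw [ih f, Function.iterate_succ_apply' _ (b + 1)]
    set g := subDeriv^[b + 1] f with hg
    have hd (r : ℝ) : HasDerivAt
        (fun r : ℝ => (r ^ (b + 1) / (b + 1).factorial * Real.exp (-r)) • g r)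
        ((r ^ b / b.factorial * Real.exp (-r)) • g r -
          (r ^ (b + 1) / (b + 1).factorial * Real.exp (-r)) • (subDeriv g) r) r := by
      refine ((hasDerivAt_pow_div_factorial_mul_exp_neg b r).fun_smul
        (g.hasDerivAt r)).congr_deriv ?_
      rw [subDeriv_apply, sub_smul, smul_sub]
      ring
    have := integral_Ioi_of_hasDerivAt_of_tendsto' (a := 0) (m := 0) (fun r _ => hd r)
      ((integrableOn_pow_exp_neg_smul b _).sub (integrableOn_pow_exp_neg_smul (b + 1) _))
      (tendsto_pow_exp_neg_smul (b + 1) g)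
    rw [integral_sub (integrableOn_pow_exp_neg_smul b _)
      (integrableOn_pow_exp_neg_smul (b + 1) _)] at this
    simp only [ne_eq, Nat.add_eq_zero_iff, one_ne_zero, and_false, not_false_eq_true, zero_pow,
      zero_div, zero_mul, zero_smul, sub_zero] at this
    exact sub_eq_zero.1 this

theorem iteratedDeriv_subDeriv (i : ℕ) (f : 𝓢(ℝ, ℂ)) (r : ℝ) :
    iteratedDeriv i (subDeriv f) r = iteratedDeriv i f r - iteratedDeriv (i + 1) f r := by
  have h : ⇑(subDeriv f) = ⇑f - deriv f := rfl
  have h1 : ContDiffAt ℝ i (deriv f) r := (derivCLM ℝ ℂ f).smooth i |>.contDiffAt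
  rw [h, iteratedDeriv_sub (f.smooth i).contDiffAt h1, iteratedDeriv_succ']

theorem sum_range_choose_mul_add_succ (n : ℕ) (a : ℕ → ℝ) :
    ∑ i ∈ Finset.range (n + 1), (n.choose i : ℝ) * (a i + a (i + 1)) =
      ∑ i ∈ Finset.range (n + 2), ((n + 1).choose i : ℝ) * a i := by
  rw [Finset.sum_range_succ' _ (n + 1)]
  simp only [Nat.choose_succ_succ, Nat.cast_add, add_mul, mul_add, Finset.sum_add_distrib]
  rw [Finset.sum_range_succ' (fun i => (n.choose i : ℝ) * a i),
    Finset.sum_range_succ (fun i => (n.choose (i + 1) : ℝ) * a (i + 1))]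
  simp
  ring

theorem norm_iterate_subDeriv_apply_le (n : ℕ) (f : 𝓢(ℝ, ℂ)) (r : ℝ) :
    ‖(subDeriv^[n] f) r‖ ≤
      ∑ i ∈ Finset.range (n + 1), (n.choose i : ℝ) * ‖iteratedDeriv i f r‖ := by
  induction n generalizing f with
  | zero => simp
  | succ n ih =>
    rw [Function.iterate_succ_apply, ← sum_range_choose_mul_add_succ]
    refine (ih (subDeriv f)).trans (Finset.sum_le_sum fun i _ => ?_)
    rw [iteratedDeriv_subDeriv]
    gcongr
    exact norm_sub_le _ _

theorem enorm_apply_zero_le (b : ℕ) (f : 𝓢(ℝ, ℂ)) :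
    ‖f 0‖ₑ ≤ ∑ i ∈ Finset.range (b + 2), ((b + 1).choose i : ℝ≥0∞) *
      ∫⁻ r in Ioi (0 : ℝ), ENNReal.ofReal (r ^ b / b.factorial * Real.exp (-r)) *
        ‖iteratedDeriv i f r‖ₑ := by
  rw [apply_zero_eq_integral_pow_exp_neg b f]
  refine (enorm_integral_le_lintegral_enorm _).trans ?_
  have hm (i : ℕ) : Measurable fun r : ℝ => ENNReal.ofReal (r ^ b / b.factorial * Real.exp (-r)) *
        ‖iteratedDeriv i f r‖ₑ := by
    have := (f.smooth ⊤).continuous_iteratedDeriv i (by exact_mod_cast le_top)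
    fun_prop
  simp_rw [← lintegral_const_mul _ (hm _)]
  rw [← lintegral_finsetSum _ fun i _ => (hm i).const_mul _]
  refine setLIntegral_mono' measurableSet_Ioi fun r hr => ?_
  have hr : 0 < r := hr
  rw [enorm_smul, Real.enorm_of_nonneg (by positivity)]
  simp_rw [mul_left_comm _ (ENNReal.ofReal _), ← Finset.mul_sum]
  gcongr
  have := ENNReal.ofReal_le_ofReal (norm_iterate_subDeriv_apply_le (b + 1) f r)
  rw [ENNReal.ofReal_sum_of_nonneg (fun i _ => by positivity)] at this
  simpa [ENNReal.ofReal_mul, ofReal_norm] using this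

/-- The power `⟨x⟩ ^ a` of the Japanese bracket. -/
def wt {E : Type*} [NormedAddCommGroup E] (a : ℝ) (x : E) : ℝ := (1 + ‖x‖ ^ 2) ^ (a / 2)

section Weight
variable {E : Type*} [NormedAddCommGroup E]

theorem wt_pos (a : ℝ) (x : E) : 0 < wt a x := by unfold wt; positivity

theorem wt_nonneg (a : ℝ) (x : E) : 0 ≤ wt a x := (wt_pos a x).le

theorem wt_add (a b : ℝ) (x : E) : wt (a + b) x = wt a x * wt b x := by
  unfold wt; rw [← Real.rpow_add (by positivity), add_div]

theorem wt_zero (x : E) : wt 0 x = 1 := by simp [wt]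

theorem wt_rpow (a p : ℝ) (x : E) : wt a x ^ p = wt (a * p) x := by
  unfold wt; rw [← Real.rpow_mul (by positivity)]; ring_nf

theorem wt_le_wt {a b : ℝ} (hab : a ≤ b) (x : E) : wt a x ≤ wt b x :=
  Real.rpow_le_rpow_of_exponent_le (by nlinarith [sq_nonneg ‖x‖]) (by linarith)

theorem wt_le_wt_of_norm_le {a : ℝ} (ha : 0 ≤ a) {x y : E} (h : ‖x‖ ≤ ‖y‖) : wt a x ≤ wt a y :=
  Real.rpow_le_rpow (by positivity) (by gcongr) (by linarith)

@[fun_prop]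
theorem continuous_wt (a : ℝ) : Continuous (wt a : E → ℝ) := by
  unfold wt
  exact Continuous.rpow_const (by fun_prop) fun x => Or.inl (by positivity)

end Weight

section Polar
variable {E : Type*} [NormedAddCommGroup E] [NormedSpace ℝ E] [MeasurableSpace E] [BorelSpace E]
  [FiniteDimensional ℝ E] [Nontrivial E] (μ : Measure E) [μ.IsAddHaarMeasure]

theorem lintegral_eq_lintegral_toSphere {f : E → ℝ≥0∞} (hf : Measurable f) :
    ∫⁻ x, f x ∂μ = ∫⁻ ω, (∫⁻ r in Ioi (0 : ℝ),
      ENNReal.ofReal (r ^ (Module.finrank ℝ E - 1)) * f (r • (ω : E))) ∂μ.toSphere := by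
  have hg : Measurable fun p : Metric.sphere (0 : E) 1 × Ioi (0 : ℝ) =>
      f ((p.2 : ℝ) • (p.1 : E)) := by fun_prop
  calc
    ∫⁻ x, f x ∂μ = ∫⁻ x : ({(0)}ᶜ : Set E), f x.1 ∂(μ.comap (↑)) := by
      rw [lintegral_subtype_comap (measurableSet_singleton _).compl f,
        restrict_compl_singleton]
    _ = ∫⁻ p, f ((p.2 : ℝ) • (p.1 : E))
          ∂μ.toSphere.prod (.volumeIoiPow (Module.finrank ℝ E - 1)) := by
      rw [← μ.measurePreserving_homeomorphUnitSphereProd.lintegral_comp hg]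
      refine lintegral_congr fun x => ?_
      have hx : ‖x.1‖ ≠ 0 := norm_ne_zero_iff.2 x.2
      simp [smul_smul, hx]
    _ = _ := by
      rw [lintegral_prod _ hg.aemeasurable]
      refine lintegral_congr fun ω => ?_
      have hf' : Measurable fun r : ℝ => f (r • (ω : E)) := by fun_prop
      rw [Measure.volumeIoiPow, lintegral_withDensity_eq_lintegral_mul _ (by fun_prop)
        (by fun_prop)]
      simp only [Pi.mul_apply]
      exact lintegral_subtype_comap measurableSet_Ioi
        fun r : ℝ => ENNReal.ofReal (r ^ (Module.finrank ℝ E - 1)) * f (r • (ω : E))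

end Polar

theorem norm_iteratedDeriv_comp_line_le {E : Type*} [NormedAddCommGroup E] [NormedSpace ℝ E]
    (h : 𝓢(E, ℂ)) (x₀ ω : E) (hω : ‖ω‖ = 1) (i : ℕ) (r : ℝ) :
    ‖iteratedDeriv i (fun r : ℝ => h (x₀ + r • ω)) r‖ ≤
      ‖iteratedFDeriv ℝ i h (x₀ + r • ω)‖ := by
  rw [← norm_iteratedFDeriv_eq_norm_iteratedDeriv]
  have hc : ContDiff ℝ i fun z => h (x₀ + z) := (h.smooth i).comp (by fun_prop)
  have := (ContinuousLinearMap.toSpanSingleton ℝ ω).iteratedFDeriv_comp_right hc r le_rfl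
  have h2 : (fun z => h (x₀ + z)) ∘ (ContinuousLinearMap.toSpanSingleton ℝ ω) =
    fun r : ℝ => h (x₀ + r • ω) := by ext; simp
  rw [h2, iteratedFDeriv_comp_add_left] at this
  rw [this]
  refine (ContinuousMultilinearMap.norm_compContinuousLinearMap_le _ _).trans ?_
  simp [hω]

theorem enorm_apply_le_sum_lintegral_ray {E : Type*} [NormedAddCommGroup E] [NormedSpace ℝ E]
    (b : ℕ) (h : 𝓢(E, ℂ)) (x₀ ω : E) (hω : ‖ω‖ = 1) :
    ‖h x₀‖ₑ ≤ ∑ i ∈ Finset.range (b + 2), ((b + 1).choose i : ℝ≥0∞) *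
      ∫⁻ r in Ioi (0 : ℝ), ENNReal.ofReal (r ^ b / b.factorial * Real.exp (-r)) *
        ‖iteratedFDeriv ℝ i h (x₀ + r • ω)‖ₑ := by
  let f : 𝓢(ℝ, ℂ) := compCLMOfAntilipschitz (K := 1) (g := fun r : ℝ => x₀ + r • ω) ℝ
    (by fun_prop) (AntilipschitzWith.of_le_mul_dist fun r s => by
      simp [dist_eq_norm, ← sub_smul, norm_smul, hω]) h
  have hf : ⇑f = fun r : ℝ => h (x₀ + r • ω) := rfl
  have := enorm_apply_zero_le b f
  rw [hf] at this
  simp only [zero_smul, add_zero] at this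
  refine this.trans ?_
  gcongr with i _ r
  exact enorm_le_iff_norm_le.2 (norm_iteratedDeriv_comp_line_le h x₀ ω hω i r)

section HalfSpace
variable {d : ℕ}

/-- Reflect `y` through the origin, if necessary, into the half-space `{y | 0 ≤ ⟪x₀, y⟫}`. -/
def flipTo (x₀ y : Euc d) : Euc d := if 0 ≤ inner ℝ x₀ y then y else -y

theorem flipTo_eq_or (x₀ y : Euc d) : flipTo x₀ y = y ∨ flipTo x₀ y = -y := by
  unfold flipTo; split_ifs <;> simp

theorem norm_flipTo (x₀ y : Euc d) : ‖flipTo x₀ y‖ = ‖y‖ := by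
  rcases flipTo_eq_or x₀ y with h | h <;> simp [h]

theorem flipTo_smul (x₀ y : Euc d) {r : ℝ} (hr : 0 < r) :
    flipTo x₀ (r • y) = r • flipTo x₀ y := by
  unfold flipTo
  simp only [inner_smul_right, mul_nonneg_iff_of_pos_left hr]
  split_ifs <;> simp

theorem norm_le_norm_add_flipTo (x₀ y : Euc d) : ‖x₀‖ ≤ ‖x₀ + flipTo x₀ y‖ := by
  have hi : 0 ≤ inner ℝ x₀ (flipTo x₀ y) := by
    unfold flipTo
    split_ifs with h
    · exact h
    · rw [inner_neg_right]; linarith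
  have := norm_add_sq_real x₀ (flipTo x₀ y)
  exact le_of_sq_le_sq (by nlinarith [sq_nonneg ‖flipTo x₀ y‖]) (norm_nonneg _)

@[fun_prop]
theorem measurable_flipTo (x₀ : Euc d) : Measurable (flipTo x₀) := by
  unfold flipTo
  exact Measurable.ite (measurableSet_le (by fun_prop) (by fun_prop)) measurable_id measurable_neg

theorem lintegral_add_flipTo_le {G : Euc d → ℝ≥0∞} (hG : Measurable G) (x₀ : Euc d) :
    ∫⁻ y, G (x₀ + flipTo x₀ y) ≤ 2 * ∫⁻ x, G x := by
  calc ∫⁻ y, G (x₀ + flipTo x₀ y) ≤ ∫⁻ y, (G (x₀ + y) + G (x₀ - y)) := by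
        refine lintegral_mono fun y => ?_
        rcases flipTo_eq_or x₀ y with h | h <;> simp [h, sub_eq_add_neg]
    _ = 2 * ∫⁻ x, G x := by
        rw [lintegral_add_left (by fun_prop), lintegral_add_left_eq_self G x₀,
          lintegral_sub_left_eq_self G x₀, two_mul]

end HalfSpace

section Kernel

/-- The radial kernel obtained by averaging `apply_zero_eq_integral_pow_exp_neg` over rays. -/
def rayKernel (d b : ℕ) (r : ℝ) : ℝ := r ^ b / b.factorial * Real.exp (-r) / r ^ (d - 1)

theorem rayKernel_nonneg (d b : ℕ) {r : ℝ} (hr : 0 ≤ r) : 0 ≤ rayKernel d b r := by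
  unfold rayKernel; positivity

@[fun_prop]
theorem measurable_rayKernel (d b : ℕ) : Measurable (rayKernel d b) := by
  unfold rayKernel; fun_prop

theorem lintegral_pow_mul_exp_neg_two (n : ℕ) :
    ∫⁻ r in Ioi (0 : ℝ), ENNReal.ofReal (r ^ n * Real.exp (-(2 * r))) =
      ENNReal.ofReal (n.factorial / 2 ^ (n + 1)) := by
  have h := Real.integral_rpow_mul_exp_neg_mul_Ioi (a := n + 1) (r := 2) (by positivity)
    (by norm_num)
  have hi : IntegrableOn (fun r : ℝ => r ^ n * Real.exp (-(2 * r))) (Ioi 0) := by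
    by_contra hc
    have h0 : ∫ r in Ioi (0 : ℝ), r ^ n * Real.exp (-(2 * r)) = 0 := integral_undef hc
    simp only [add_sub_cancel_right, Real.rpow_natCast] at h
    rw [h0, Real.Gamma_nat_eq_factorial] at h
    have : (0 : ℝ) < (1 / 2) ^ ((n : ℝ) + 1) * n.factorial := by positivity
    linarith
  rw [← ofReal_integral_eq_lintegral_ofReal hi]
  · simp only [add_sub_cancel_right, Real.rpow_natCast] at h
    rw [h, Real.Gamma_nat_eq_factorial]
    congr 1
    have : (1 / 2 : ℝ) ^ ((n : ℝ) + 1) = (1 / 2) ^ (n + 1) := by exact_mod_cast Real.rpow_natCast _ _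
    rw [this, one_div, inv_pow]
    ring
  · filter_upwards [ae_restrict_mem measurableSet_Ioi] with r hr
    have hr : 0 < r := hr
    positivity

theorem lintegral_rayKernel_sq (d b n : ℕ) (hd : 1 ≤ d) (hn : d + n = 2 * b + 1) :
    ∫⁻ y : Euc d, ENNReal.ofReal (rayKernel d b ‖y‖ ^ 2) =
      ENNReal.ofReal (n.factorial / 2 ^ (n + 1) / b.factorial ^ 2) *
        (volume : Measure (Euc d)).toSphere univ := by
  have : Nonempty (Fin d) := ⟨⟨0, hd⟩⟩
  rw [lintegral_eq_lintegral_toSphere _ (by fun_prop)]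
  rw [← lintegral_const]
  refine lintegral_congr fun ω => ?_
  rw [div_eq_mul_inv _ ((b.factorial : ℝ) ^ 2), ENNReal.ofReal_mul (by positivity),
    ← lintegral_pow_mul_exp_neg_two, ← lintegral_mul_const _ (by fun_prop)]
  refine setLIntegral_congr_fun measurableSet_Ioi fun r hr => ?_
  have hr : 0 < r := hr
  have hω : ‖(ω : Euc d)‖ = 1 := by simp
  simp only [norm_smul, hω, mul_one, Real.norm_of_nonneg hr.le, finrank_euclideanSpace_fin]
  rw [← ENNReal.ofReal_mul (by positivity), ← ENNReal.ofReal_mul (by positivity)]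
  congr 1
  unfold rayKernel
  have h1 : Real.exp (-(2 * r)) = Real.exp (-r) ^ 2 := by
    rw [← Real.exp_nat_mul]; ring_nf
  have h2 : r ^ n * r ^ (d - 1) = r ^ b * r ^ b := by
    rw [← pow_add, ← pow_add]; congr 1; omega
  rw [h1]
  field_simp
  linear_combination (-1 : ℝ) * h2

end Kernel

theorem toSphere_univ_euc (d : ℕ) (hd : 1 ≤ d) :
    (volume : Measure (Euc d)).toSphere univ =
      ENNReal.ofReal (d * (√Real.pi ^ d / Real.Gamma (d / 2 + 1))) := by
  have : Nonempty (Fin d) := ⟨⟨0, hd⟩⟩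
  rw [Measure.toSphere_apply_univ, EuclideanSpace.volume_ball, finrank_euclideanSpace_fin,
    ENNReal.ofReal_mul (by positivity)]
  simp

theorem four_pow_le_sphere_area (d : ℕ) (hd : 1 ≤ d) :
    (4 : ℝ) ^ (d / 2) ≤ ((d / 2).factorial : ℝ) ^ 2 * 2 ^ (2 * (d / 2) + 1 - d) *
      (d * (√Real.pi ^ d / Real.Gamma (d / 2 + 1))) := by
  induction d using Nat.twoStepInduction with
  | zero => omega
  | one =>
    have h : Real.Gamma ((1 : ℕ) / 2 + 1) = 1 / 2 * √Real.pi := by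
      rw [Nat.cast_one, Real.Gamma_add_one (by norm_num), Real.Gamma_one_half_eq]
    have : (0 : ℝ) < √Real.pi := by positivity
    rw [h]
    norm_num
    field_simp
    norm_num
  | more d ih _ =>
    rcases Nat.eq_zero_or_pos d with rfl | hd0
    · have := Real.pi_gt_three
      norm_num
      rw [Real.sq_sqrt Real.pi_pos.le]
      linarith
    have ih := ih hd0
    have hG : Real.Gamma (((d + 2 : ℕ) : ℝ) / 2 + 1) =
        ((d : ℝ) / 2 + 1) * Real.Gamma (d / 2 + 1) := by
      rw [← Real.Gamma_add_one (by positivity)]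
      congr 1; push_cast; ring
    have hq : (d + 2) / 2 = d / 2 + 1 := by omega
    have he : 2 * (d / 2 + 1) + 1 - (d + 2) = 2 * (d / 2) + 1 - d := by omega
    have hΓ : 0 < Real.Gamma ((d : ℝ) / 2 + 1) := Real.Gamma_pos_of_pos (by positivity)
    have hd' : (0 : ℝ) < d := by exact_mod_cast hd0
    set σ : ℝ := d * (√Real.pi ^ d / Real.Gamma (d / 2 + 1)) with hσ
    have hσ0 : 0 < σ := by positivity
    have hs : ((d + 2 : ℕ) : ℝ) * (√Real.pi ^ (d + 2) / (((d : ℝ) / 2 + 1) *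
        Real.Gamma (d / 2 + 1))) = 2 * Real.pi / d * σ := by
      rw [hσ, pow_add, Real.sq_sqrt Real.pi_pos.le]
      push_cast
      field_simp
    rw [hq, he, hG, hs, Nat.factorial_succ, pow_succ]
    have hb : (d : ℝ) ≤ 2 * (d / 2 : ℕ) + 1 := by exact_mod_cast (by omega : d ≤ 2 * (d / 2) + 1)
    have hk : 4 ≤ (((d / 2 : ℕ) : ℝ) + 1) ^ 2 * (2 * Real.pi / d) := by
      rw [← mul_div_assoc, le_div_iff₀ hd']
      have := Real.pi_gt_three
      nlinarith [sq_nonneg ((d / 2 : ℕ) : ℝ),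
        mul_nonneg (sq_nonneg (((d / 2 : ℕ) : ℝ) + 1)) (by linarith : 0 ≤ Real.pi - 3)]
    push_cast
    calc (4 : ℝ) ^ (d / 2) * 4 ≤ (((d / 2).factorial : ℝ) ^ 2 * 2 ^ (2 * (d / 2) + 1 - d) * σ) *
          ((((d / 2 : ℕ) : ℝ) + 1) ^ 2 * (2 * Real.pi / d)) := by gcongr
      _ = _ := by ring

theorem choose_succ_le_two_pow (b i : ℕ) : (b + 1).choose i ≤ 2 ^ b := by
  rcases i with _ | i
  · simpa using Nat.one_le_two_pow
  · rw [Nat.choose_succ_succ, ← Nat.sum_range_choose]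
    rcases lt_or_ge b (i + 1) with h | h
    · rw [Nat.choose_eq_zero_of_lt h, add_zero]
      rcases lt_or_ge b i with h' | h'
      · simp [Nat.choose_eq_zero_of_lt h']
      · exact Finset.single_le_sum (f := fun i => b.choose i) (fun _ _ => Nat.zero_le _)
          (Finset.mem_range.2 (by omega))
    · rw [← Finset.sum_pair (f := fun i => b.choose i) (by omega : i ≠ i + 1)]
      refine Finset.sum_le_sum_of_subset fun j hj => ?_
      simp only [Finset.mem_insert, Finset.mem_singleton] at hj
      exact Finset.mem_range.2 (by omega)

/-- Averaging the one-dimensional representation over the rays of a half-space. -/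
theorem toSphere_univ_mul_enorm_apply_le {d : ℕ} (hd : 1 ≤ d) (b : ℕ) (h : 𝓢(Euc d, ℂ))
    (x₀ : Euc d) :
    (volume : Measure (Euc d)).toSphere univ * ‖h x₀‖ₑ ≤
      ∑ i ∈ Finset.range (b + 2), ((b + 1).choose i : ℝ≥0∞) *
        ∫⁻ y : Euc d, ENNReal.ofReal (rayKernel d b ‖y‖) *
          ‖iteratedFDeriv ℝ i h (x₀ + flipTo x₀ y)‖ₑ := by
  have : Nonempty (Fin d) := ⟨⟨0, hd⟩⟩
  have hm (i : ℕ) : Measurable fun x => ‖iteratedFDeriv ℝ i h x‖ₑ :=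
    ((h.smooth ⊤).continuous_iteratedFDeriv (by exact_mod_cast le_top)).enorm.measurable
  have hm' (i : ℕ) : Measurable fun y : Euc d => ENNReal.ofReal (rayKernel d b ‖y‖) *
      ‖iteratedFDeriv ℝ i h (x₀ + flipTo x₀ y)‖ₑ :=
    Measurable.mul (by fun_prop) ((hm i).comp (by fun_prop))
  simp_rw [← lintegral_const_mul _ (hm' _)]
  rw [← lintegral_finsetSum _ fun i _ => (hm' i).const_mul _, lintegral_eq_lintegral_toSphere _
    (Finset.measurable_fun_sum _ fun i _ => (hm' i).const_mul _), mul_comm, ← lintegral_const]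
  refine lintegral_mono fun ω => ?_
  have hω : ‖(ω : Euc d)‖ = 1 := by simp
  refine (enorm_apply_le_sum_lintegral_ray b h x₀ (flipTo x₀ ω)
    ((norm_flipTo x₀ ω).trans hω)).trans ?_
  have hm2 (i : ℕ) : Measurable fun r : ℝ =>
      ENNReal.ofReal (r ^ b / b.factorial * Real.exp (-r)) *
        ‖iteratedFDeriv ℝ i h (x₀ + r • flipTo x₀ ω)‖ₑ :=
    Measurable.mul (by fun_prop) ((hm i).comp (by fun_prop))
  simp_rw [← lintegral_const_mul _ (hm2 _)]
  rw [← lintegral_finsetSum _ fun i _ => (hm2 i).const_mul _]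
  refine setLIntegral_mono' measurableSet_Ioi fun r hr => ?_
  have hr : 0 < r := hr
  rw [Finset.mul_sum]
  refine Finset.sum_le_sum fun i _ => le_of_eq ?_
  rw [flipTo_smul _ _ hr, norm_smul, hω, mul_one, Real.norm_of_nonneg hr.le,
    finrank_euclideanSpace_fin]
  have hk : ENNReal.ofReal (r ^ b / b.factorial * Real.exp (-r)) =
      ENNReal.ofReal (r ^ (d - 1)) * ENNReal.ofReal (rayKernel d b r) := by
    rw [← ENNReal.ofReal_mul (by positivity)]
    congr 1
    unfold rayKernel
    field_simp
  rw [hk]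
  ring

theorem ofReal_wt_mul_enorm_apply_le (d m : ℕ) (hd : 1 ≤ d) (s : ℝ) (hs : 0 ≤ s)
    (hsm : s + d / 2 + 1 ≤ m) (h : 𝓢(Euc d, ℂ)) (x₀ : Euc d) :
    ENNReal.ofReal (wt s x₀) * ‖h x₀‖ₑ ≤ HmmNorm d m h := by
  set b := d / 2 with hb
  set n := 2 * b + 1 - d with hn
  set σ : ℝ≥0∞ := (volume : Measure (Euc d)).toSphere univ with hσ
  set S : ℝ := d * (√Real.pi ^ d / Real.Gamma (d / 2 + 1)) with hS
  have hd0 : (0 : ℝ) < d := by exact_mod_cast hd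
  have hS0 : 0 < S := by
    have : 0 < Real.Gamma ((d : ℝ) / 2 + 1) := Real.Gamma_pos_of_pos (by positivity)
    positivity
  have hσS : σ = ENNReal.ofReal S := toSphere_univ_euc d hd
  have hbd : (b : ℝ) ≤ d / 2 := by
    rw [le_div_iff₀ two_pos]; exact_mod_cast (by omega : b * 2 ≤ d)
  have hbm : b + 1 ≤ m := by
    have : ((b + 1 : ℕ) : ℝ) ≤ m := by push_cast; linarith
    exact_mod_cast this
  have hn1 : n.factorial = 1 := by
    have : n = 0 ∨ n = 1 := by omega
    rcases this with h | h <;> simp [h]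
  let G (i : ℕ) (x : Euc d) : ℝ := wt (m - i) x * ‖iteratedFDeriv ℝ i h x‖
  have hGm (i : ℕ) : Measurable (G i) := by
    have := (h.smooth ⊤).continuous_iteratedFDeriv (m := i) (by exact_mod_cast le_top)
    exact ((continuous_wt _).mul this.norm).measurable
  have hG0 (i : ℕ) (x : Euc d) : 0 ≤ G i x := mul_nonneg (wt_nonneg _ _) (norm_nonneg _)
  let N (i : ℕ) : ℝ≥0∞ := eLpNorm (G i) 2 volume
  have hN (i : ℕ) : N i = (∫⁻ x, ENNReal.ofReal (G i x) ^ (2 : ℝ)) ^ (1 / 2 : ℝ) := by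
    simp only [N]
    rw [eLpNorm_eq_lintegral_rpow_enorm_toReal (by norm_num) (by norm_num)]
    simp [Real.enorm_of_nonneg (hG0 i _)]
  have hNH : ∑ i ∈ Finset.range (b + 2), N i ≤ HmmNorm d m h :=
    Finset.sum_le_sum_of_subset (Finset.range_mono (by omega))
  have key (i : ℕ) (hi : i ∈ Finset.range (b + 2)) :
      ((b + 1).choose i : ℝ≥0∞) * (ENNReal.ofReal (wt s x₀) *
        ∫⁻ y : Euc d, ENNReal.ofReal (rayKernel d b ‖y‖) *
          ‖iteratedFDeriv ℝ i h (x₀ + flipTo x₀ y)‖ₑ) ≤ σ * N i := by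
    have hi' : (i : ℝ) ≤ d / 2 + 1 := by
      have : i ≤ b + 1 := by simp at hi; omega
      have : (i : ℝ) ≤ b + 1 := by exact_mod_cast this
      linarith
    have h1 : ENNReal.ofReal (wt s x₀) *
        (∫⁻ y : Euc d, ENNReal.ofReal (rayKernel d b ‖y‖) *
          ‖iteratedFDeriv ℝ i h (x₀ + flipTo x₀ y)‖ₑ) ≤
        ∫⁻ y : Euc d, ENNReal.ofReal (rayKernel d b ‖y‖) *
          ENNReal.ofReal (G i (x₀ + flipTo x₀ y)) := by
      rw [← lintegral_const_mul' _ _ ENNReal.ofReal_ne_top]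
      refine lintegral_mono fun y => ?_
      rw [mul_left_comm, ← ofReal_norm, ← ENNReal.ofReal_mul (wt_nonneg _ _)]
      refine mul_le_mul_right (ENNReal.ofReal_le_ofReal ?_) _
      refine mul_le_mul_of_nonneg_right ?_ (norm_nonneg _)
      exact (wt_le_wt_of_norm_le hs (norm_le_norm_add_flipTo x₀ y)).trans
        (wt_le_wt (by linarith) _)
    have h2 := ENNReal.lintegral_mul_le_Lp_mul_Lq (volume : Measure (Euc d))
      (Real.HolderConjugate.two_two)
      (f := fun y => ENNReal.ofReal (rayKernel d b ‖y‖))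
      (g := fun y => ENNReal.ofReal (G i (x₀ + flipTo x₀ y)))
      (by fun_prop) (((hGm i).comp (by fun_prop)).ennreal_ofReal.aemeasurable)
    have h3 : ∫⁻ y : Euc d, ENNReal.ofReal (rayKernel d b ‖y‖) ^ (2 : ℝ) =
        ENNReal.ofReal (1 / 2 ^ (n + 1) / b.factorial ^ 2 * S) := by
      rw [ENNReal.ofReal_mul (by positivity), ← hσS]
      have := lintegral_rayKernel_sq d b n hd (by omega)
      rw [hn1, Nat.cast_one] at this
      rw [← this]
      refine lintegral_congr fun y => ?_
      rw [ENNReal.rpow_two, ENNReal.ofReal_pow (rayKernel_nonneg _ _ (norm_nonneg _))]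
    have h4 : ∫⁻ y : Euc d, ENNReal.ofReal (G i (x₀ + flipTo x₀ y)) ^ (2 : ℝ) ≤
        2 * ∫⁻ x, ENNReal.ofReal (G i x) ^ (2 : ℝ) :=
      lintegral_add_flipTo_le (G := fun x => ENNReal.ofReal (G i x) ^ (2 : ℝ))
        ((hGm i).ennreal_ofReal.pow_const _) x₀
    calc _ ≤ ((b + 1).choose i : ℝ≥0∞) *
          ((ENNReal.ofReal (1 / 2 ^ (n + 1) / b.factorial ^ 2 * S)) ^ (1 / 2 : ℝ) *
            (2 * ∫⁻ x, ENNReal.ofReal (G i x) ^ (2 : ℝ)) ^ (1 / 2 : ℝ)) := by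
          refine mul_le_mul_right ((h1.trans h2).trans ?_) _
          rw [h3]
          gcongr
      _ = ((b + 1).choose i : ℝ≥0∞) *
          (ENNReal.ofReal (1 / 2 ^ (n + 1) / b.factorial ^ 2 * S) * 2) ^ (1 / 2 : ℝ) * N i := by
          rw [hN, ENNReal.mul_rpow_of_nonneg _ _ (by norm_num),
            ENNReal.mul_rpow_of_nonneg _ _ (by norm_num)]
          ring
      _ ≤ σ * N i := by
          gcongr
          have hc : ((b + 1).choose i : ℝ) ^ 2 ≤ b.factorial ^ 2 * 2 ^ n * S := by
            refine le_trans ?_ (four_pow_le_sphere_area d hd)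
            have : ((b + 1).choose i : ℝ) ≤ 2 ^ b := by exact_mod_cast choose_succ_le_two_pow b i
            calc ((b + 1).choose i : ℝ) ^ 2 ≤ (2 ^ b) ^ 2 := by gcongr
              _ = 4 ^ b := by rw [← pow_mul, mul_comm, pow_mul]; norm_num
          have e2 : (2 : ℝ≥0∞) = ENNReal.ofReal 2 := by norm_num
          rw [hσS, e2, ← ENNReal.ofReal_mul (by positivity),
            ENNReal.ofReal_rpow_of_nonneg (by positivity) (by norm_num), ← Real.sqrt_eq_rpow,
            ← ENNReal.ofReal_natCast, ← ENNReal.ofReal_mul (by positivity)]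
          refine ENNReal.ofReal_le_ofReal (le_of_sq_le_sq ?_ hS0.le)
          rw [mul_pow, Real.sq_sqrt (by positivity)]
          have hf : (0 : ℝ) < b.factorial := by positivity
          calc _ ≤ (b.factorial ^ 2 * 2 ^ n * S) * (1 / 2 ^ (n + 1) / b.factorial ^ 2 * S * 2) := by
                gcongr
            _ = S ^ 2 := by rw [pow_succ 2 n]; field_simp
  have hfin : σ * (ENNReal.ofReal (wt s x₀) * ‖h x₀‖ₑ) ≤ σ * HmmNorm d m h := by
    calc σ * (ENNReal.ofReal (wt s x₀) * ‖h x₀‖ₑ) = ENNReal.ofReal (wt s x₀) * (σ * ‖h x₀‖ₑ) := by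
          ring
      _ ≤ _ := mul_le_mul_right (toSphere_univ_mul_enorm_apply_le hd b h x₀) _
      _ ≤ ∑ i ∈ Finset.range (b + 2), σ * N i := by
          rw [Finset.mul_sum]
          refine Finset.sum_le_sum fun i hi => ?_
          rw [mul_left_comm]
          exact key i hi
      _ ≤ _ := by
          rw [← Finset.mul_sum]
          exact mul_le_mul_right hNH _
  refine (ENNReal.mul_le_mul_iff_right ?_ ?_).1 hfin
  · simpa [hσS] using hS0
  · simp [hσS]

theorem exists_hasFDerivAt_norm_rpow_smul {q : ℝ} (hq : 0 < q) (z : ℂ) :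
    ∃ L : ℂ →L[ℝ] ℂ, HasFDerivAt (fun z : ℂ => ‖z‖ ^ q • z) L z ∧
      ∀ w, ‖L w‖ ≤ (1 + q) * ‖z‖ ^ q * ‖w‖ := by
  rcases eq_or_ne z 0 with rfl | hz
  · refine ⟨0, ?_, fun w => ?_⟩
    · rw [hasFDerivAt_iff_isLittleO_nhds_zero]
      simp only [zero_add, norm_zero, smul_zero, sub_zero, _root_.zero_apply]
      have h1 : (fun h : ℂ => ‖h‖ ^ q) =o[𝓝 0] fun _ => (1 : ℝ) := by
        rw [Asymptotics.isLittleO_one_iff]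
        have : Tendsto (fun h : ℂ => ‖h‖ ^ q) (𝓝 0) (𝓝 (‖(0 : ℂ)‖ ^ q)) :=
          (continuous_norm.rpow_const fun _ => Or.inr hq.le).tendsto 0
        simpa [Real.zero_rpow hq.ne'] using this
      simpa using h1.smul_isBigO (Asymptotics.isBigO_refl (fun h : ℂ => h) (𝓝 0))
    · simp only [_root_.zero_apply, norm_zero]; positivity
  · have hz' : 0 < ‖z‖ := norm_pos_iff.2 hz
    have hn : HasFDerivAt (fun z : ℂ => ‖z‖) (fderiv ℝ (fun z : ℂ => ‖z‖) z) z :=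
      ((contDiffAt_norm (n := 1) ℝ hz).differentiableAt (by norm_num)).hasFDerivAt
    have hn1 : ‖fderiv ℝ (fun z : ℂ => ‖z‖) z‖ ≤ 1 := by
      simpa using norm_fderiv_le_of_lipschitz ℝ (x₀ := z) (lipschitzWith_one_norm (E := ℂ))
    refine ⟨_, (hn.rpow_const (p := q) (Or.inl hz'.ne')).smul (hasFDerivAt_id z), fun w => ?_⟩
    simp only [_root_.add_apply, _root_.smul_apply,
      ContinuousLinearMap.smulRight_apply, ContinuousLinearMap.id_apply]
    have hw : ‖fderiv ℝ (fun z : ℂ => ‖z‖) z w‖ ≤ ‖w‖ :=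
      (ContinuousLinearMap.le_of_opNorm_le _ hn1 w).trans (one_mul _).le
    refine (norm_add_le _ _).trans ?_
    rw [norm_smul, norm_smul, smul_eq_mul, norm_mul, Real.norm_of_nonneg (by positivity),
      Real.norm_of_nonneg (by positivity)]
    have e : ‖z‖ ^ (q - 1) * ‖z‖ = ‖z‖ ^ q := by
      rw [← Real.rpow_add_one hz'.ne', sub_add_cancel]
    calc _ ≤ ‖z‖ ^ q * ‖w‖ + q * ‖z‖ ^ (q - 1) * ‖w‖ * ‖z‖ := by gcongr
      _ = ‖z‖ ^ q * ‖w‖ + q * (‖z‖ ^ (q - 1) * ‖z‖) * ‖w‖ := by ring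
      _ = _ := by rw [e]; ring

theorem norm_le_wt_one {E : Type*} [NormedAddCommGroup E] (x : E) : ‖x‖ ≤ wt 1 x := by
  unfold wt
  rw [← Real.sqrt_eq_rpow]
  exact Real.le_sqrt_of_sq_le (by linarith)

theorem exists_hasFDerivAt_wt {E : Type*} [NormedAddCommGroup E] [InnerProductSpace ℝ E]
    (c : ℝ) (x : E) :
    ∃ L : E →L[ℝ] ℝ, HasFDerivAt (wt c) L x ∧ ∀ w, |L w| ≤ |c| * wt (c - 1) x * ‖w‖ := by
  have h0 : HasFDerivAt (fun x : E => 1 + ‖x‖ ^ 2) (2 • innerSL ℝ x) x :=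
    (hasStrictFDerivAt_norm_sq x).hasFDerivAt.const_add 1
  refine ⟨_, h0.rpow_const (p := c / 2) (Or.inl (by positivity)), fun w => ?_⟩
  have e : (1 + ‖x‖ ^ 2) ^ (c / 2 - 1) = wt (c - 2) x := by unfold wt; congr 1; ring
  have e2 : wt (c - 1) x = wt (c - 2) x * wt 1 x := by rw [← wt_add]; congr 1; ring
  simp only [_root_.smul_apply, innerSL_apply_apply, smul_eq_mul, e, nsmul_eq_mul]
  rw [abs_mul, abs_mul, abs_mul, abs_div, abs_of_pos (wt_pos _ _), e2]
  have h2 := abs_real_inner_le_norm x w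
  calc _ ≤ |c| / |2| * wt (c - 2) x * (|((2 : ℕ) : ℝ)| * (wt 1 x * ‖w‖)) := by
        have := wt_nonneg (c - 2) x
        have h1 : |inner ℝ x w| ≤ wt 1 x * ‖w‖ :=
          h2.trans (mul_le_mul_of_nonneg_right (norm_le_wt_one x) (norm_nonneg _))
        gcongr
    _ = _ := by norm_num; ring

theorem exists_schwartz_eq_wt_smul {d : ℕ} (c : ℝ) (f : 𝓢(Euc d, ℂ)) :
    ∃ g : 𝓢(Euc d, ℂ), ∀ x, g x = wt c x • f x := by
  have h := Function.hasTemperateGrowth_one_add_norm_sq_rpow (Euc d) (c / 2)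
  exact ⟨smulLeftCLM ℂ (fun x : Euc d => (1 + ‖x‖ ^ 2) ^ (c / 2)) f, fun x =>
    smulLeftCLM_apply_apply h f x⟩

theorem memLp_wt_mul_norm {d : ℕ} (c : ℝ) (f : 𝓢(Euc d, ℂ)) (p : ℝ≥0∞) :
    MemLp (fun x => wt c x * ‖f x‖) p := by
  obtain ⟨g, hg⟩ := exists_schwartz_eq_wt_smul c f
  refine (g.memLp p volume).norm.congr_norm ?_ (.of_forall fun x => ?_)
  · exact ((continuous_wt c).mul f.continuous.norm).aestronglyMeasurable
  · simp [hg]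

theorem integrable_of_norm_le_wt_mul {d : ℕ} {F : Type*} [NormedAddCommGroup F] {G : Euc d → F}
    (hG : AEStronglyMeasurable G) (K c : ℝ) (f : 𝓢(Euc d, ℂ))
    (h : ∀ x, ‖G x‖ ≤ K * (wt c x * ‖f x‖)) : Integrable G :=
  ((memLp_one_iff_integrable.1 (memLp_wt_mul_norm c f 1)).const_mul K).mono' hG (.of_forall h)

theorem exists_norm_le_schwartz {d : ℕ} (f : 𝓢(Euc d, ℂ)) : ∃ K, 0 ≤ K ∧ ∀ x, ‖f x‖ ≤ K :=
  ⟨SchwartzMap.seminorm ℝ 0 0 f, apply_nonneg _ _, f.norm_le_seminorm ℝ⟩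

/-- Integration by parts against `⟨x⟩^c ‖∂_v f‖^q ∂_v f`. -/
theorem lintegral_wt_mul_norm_lineDeriv_rpow_le {d : ℕ} (f : 𝓢(Euc d, ℂ)) (v : Euc d)
    (hv : ‖v‖ ≤ 1) (c : ℝ) {q : ℝ} (hq : 0 < q) :
    ∫⁻ x, ENNReal.ofReal (wt c x * ‖∂_{v} f x‖ ^ (q + 2)) ≤
      ∫⁻ x, ENNReal.ofReal ((1 + q) * (wt c x * ‖∂_{v} f x‖ ^ q * ‖∂_{v} (∂_{v} f) x‖ * ‖f x‖) +
        |c| * (wt (c - 1) x * ‖∂_{v} f x‖ ^ (q + 1) * ‖f x‖)) := by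
  set ψ : 𝓢(Euc d, ℂ) := ∂_{v} f with hψ
  let F (x : Euc d) : ℂ := wt c x • (‖ψ x‖ ^ q • ψ x)
  have hF (x : Euc d) : ∃ L : Euc d →L[ℝ] ℂ, HasFDerivAt F L x ∧
      ‖L v‖ ≤ (1 + q) * (wt c x * ‖ψ x‖ ^ q * ‖∂_{v} ψ x‖) +
        |c| * (wt (c - 1) x * ‖ψ x‖ ^ (q + 1)) := by
    obtain ⟨L1, h1, h1'⟩ := exists_hasFDerivAt_wt c x
    obtain ⟨L2, h2, h2'⟩ := exists_hasFDerivAt_norm_rpow_smul hq (ψ x)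
    have h3 : HasFDerivAt ψ (fderiv ℝ ψ x) x := ψ.differentiableAt.hasFDerivAt
    refine ⟨_, h1.smul (h2.comp x h3), ?_⟩
    simp only [_root_.add_apply, _root_.smul_apply, ContinuousLinearMap.smulRight_apply,
      ContinuousLinearMap.comp_apply]
    refine (norm_add_le _ _).trans (add_le_add ?_ ?_)
    · rw [norm_smul, Real.norm_of_nonneg (wt_nonneg _ _)]
      refine (mul_le_mul_of_nonneg_left (h2' _) (wt_nonneg _ _)).trans_eq ?_
      rw [← lineDerivOp_apply_eq_fderiv]
      ring
    · rw [norm_smul, norm_smul, Real.norm_eq_abs, Real.norm_of_nonneg (by positivity),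
        ← Real.rpow_add_one' (norm_nonneg _) (by positivity)]
      have h4 : |L1 v| ≤ |c| * wt (c - 1) x := by
        refine (h1' v).trans ?_
        have := wt_nonneg (c - 1) x
        exact mul_le_of_le_one_right (by positivity) hv
      calc _ ≤ (|c| * wt (c - 1) x) * ‖ψ x‖ ^ (q + 1) := by gcongr
        _ = _ := by ring
  choose L hL hLv using hF
  have hFc : Continuous F := continuous_iff_continuousAt.2 fun x => (hL x).continuousAt
  have hline (x : Euc d) : HasLineDerivAt ℝ F (lineDeriv ℝ F x v) x v :=
    (hL x).hasLineDerivAt v |>.lineDeriv ▸ (hL x).hasLineDerivAt v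
  have hlv (x : Euc d) : lineDeriv ℝ F x v = L x v := ((hL x).hasLineDerivAt v).lineDeriv
  have hFn (x : Euc d) : ‖F x‖ = wt c x * ‖ψ x‖ ^ (q + 1) := by
    simp only [F]
    rw [norm_smul, norm_smul, Real.norm_of_nonneg (wt_nonneg _ _),
      Real.norm_of_nonneg (by positivity), Real.rpow_add_one' (norm_nonneg _) (by positivity)]
  obtain ⟨Kψ, hKψ, hψb⟩ := exists_norm_le_schwartz ψ
  obtain ⟨Kd, hKd, hdb⟩ := exists_norm_le_schwartz (∂_{v} ψ)
  have hin (x : Euc d) : inner ℝ (F x) (ψ x) = wt c x * ‖ψ x‖ ^ (q + 2) := by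
    simp only [F]
    rw [real_inner_smul_left, real_inner_smul_left, real_inner_self_eq_norm_sq,
      ← Real.rpow_natCast, ← Real.rpow_add' (norm_nonneg _) (by push_cast; positivity)]
    norm_num
  have hi1 : Integrable (fun x => inner ℝ (F x) (ψ x)) := by
    refine integrable_of_norm_le_wt_mul (hFc.inner ψ.continuous).aestronglyMeasurable
      (Kψ ^ (q + 1)) c ψ fun x => ?_
    refine (norm_inner_le_norm _ _).trans ?_
    rw [hFn]
    have := wt_nonneg c x
    calc _ ≤ wt c x * Kψ ^ (q + 1) * ‖ψ x‖ := by gcongr; exact hψb x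
      _ = _ := by ring
  have hi2 : Integrable (fun x => inner ℝ (F x) (f x)) := by
    refine integrable_of_norm_le_wt_mul (hFc.inner f.continuous).aestronglyMeasurable
      (Kψ ^ (q + 1)) c f fun x => ?_
    refine (norm_inner_le_norm _ _).trans ?_
    rw [hFn]
    have := wt_nonneg c x
    calc _ ≤ wt c x * Kψ ^ (q + 1) * ‖f x‖ := by gcongr; exact hψb x
      _ = _ := by ring
  have hb (x : Euc d) : ‖inner ℝ (lineDeriv ℝ F x v) (f x)‖ ≤
      (1 + q) * (wt c x * ‖ψ x‖ ^ q * ‖∂_{v} ψ x‖ * ‖f x‖) +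
        |c| * (wt (c - 1) x * ‖ψ x‖ ^ (q + 1) * ‖f x‖) := by
    refine (norm_inner_le_norm _ _).trans ?_
    rw [hlv]
    refine (mul_le_mul_of_nonneg_right (hLv x) (norm_nonneg _)).trans_eq (by ring)
  have hi3 : Integrable (fun x => inner ℝ (lineDeriv ℝ F x v) (f x)) := by
    refine integrable_of_norm_le_wt_mul
      ((aestronglyMeasurable_lineDeriv hFc volume).inner f.continuous.aestronglyMeasurable)
      ((1 + q) * (Kψ ^ q * Kd) + |c| * Kψ ^ (q + 1)) c f fun x => (hb x).trans ?_
    have := wt_nonneg c x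
    have := wt_nonneg (c - 1) x
    calc _ ≤ (1 + q) * (wt c x * Kψ ^ q * Kd * ‖f x‖) + |c| * (wt c x * Kψ ^ (q + 1) * ‖f x‖) := by
          gcongr
          · exact hψb x
          · exact hdb x
          · exact wt_le_wt (by linarith) x
          · exact hψb x
      _ = _ := by ring
  have key : ∫ x, inner ℝ (F x) (ψ x) = -∫ x, inner ℝ (lineDeriv ℝ F x v) (f x) :=
    integral_bilinear_hasLineDerivAt_right_eq_neg_left_of_integrable
    (μ := (volume : Measure (Euc d))) (B := innerSL ℝ) (f := F) (g := f) (g' := ψ) (v := v)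
    (f' := fun x => lineDeriv ℝ F x v)
    hi3 hi1 hi2 (fun x _ => hline x)
    (fun x _ => f.differentiableAt.hasFDerivAt.hasLineDerivAt v)
  calc ∫⁻ x, ENNReal.ofReal (wt c x * ‖ψ x‖ ^ (q + 2))
      = ENNReal.ofReal (∫ x, inner ℝ (F x) (ψ x)) := by
        rw [ofReal_integral_eq_lintegral_ofReal hi1 (.of_forall fun x => ?_)]
        · simp_rw [hin]
        · have := wt_nonneg c x
          simp only [Pi.zero_apply, hin]; positivity
    _ ≤ ‖∫ x, inner ℝ (F x) (ψ x)‖ₑ := by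
        rw [← ofReal_norm]; exact ENNReal.ofReal_le_ofReal (Real.le_norm_self _)
    _ = ‖∫ x, inner ℝ (lineDeriv ℝ F x v) (f x)‖ₑ := by rw [key, enorm_neg]
    _ ≤ ∫⁻ x, ‖inner ℝ (lineDeriv ℝ F x v) (f x)‖ₑ := enorm_integral_le_lintegral_enorm _
    _ ≤ _ := by
        refine lintegral_mono fun x => ?_
        rw [← ofReal_norm]
        exact ENNReal.ofReal_le_ofReal (hb x)

/-- The `L^{1/θ}` norm, with `θ = 0` corresponding to `L^∞`. -/
def nrm {d : ℕ} (θ : ℝ) (f : Euc d → ℝ) : ℝ≥0∞ := eLpNorm f (ENNReal.ofReal θ)⁻¹ volume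

section
variable {d : ℕ}

theorem nrm_mono {θ : ℝ} {f g : Euc d → ℝ} (hf : ∀ x, 0 ≤ f x) (h : ∀ x, f x ≤ g x) :
    nrm θ f ≤ nrm θ g :=
  eLpNorm_mono_real fun x => by rw [Real.norm_of_nonneg (hf x)]; exact h x

theorem nrm_half (f : Euc d → ℝ) : nrm (1 / 2) f = eLpNorm f 2 volume := by
  unfold nrm
  congr 1
  rw [one_div, ENNReal.ofReal_inv_of_pos two_pos, inv_inv]
  norm_num

theorem nrm_one {f : Euc d → ℝ} (hf : ∀ x, 0 ≤ f x) :
    nrm 1 f = ∫⁻ x, ENNReal.ofReal (f x) := by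
  unfold nrm
  rw [ENNReal.ofReal_one, inv_one, eLpNorm_one_eq_lintegral_enorm]
  exact lintegral_congr fun x => Real.enorm_of_nonneg (hf x)

theorem nrm_zero_le {f : Euc d → ℝ} (hf : ∀ x, 0 ≤ f x) {H : ℝ≥0∞}
    (h : ∀ x, ENNReal.ofReal (f x) ≤ H) : nrm 0 f ≤ H := by
  unfold nrm
  rw [ENNReal.ofReal_zero, ENNReal.inv_zero, eLpNorm_exponent_top]
  refine eLpNormEssSup_le_of_ae_enorm_bound (.of_forall fun x => ?_)
  rw [Real.enorm_of_nonneg (hf x)]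
  exact h x

theorem nrm_mul_le {θ₁ θ₂ : ℝ} (h₁ : 0 ≤ θ₁) (h₂ : 0 ≤ θ₂) {f g : Euc d → ℝ}
    (hf : AEStronglyMeasurable f) (hg : AEStronglyMeasurable g) :
    nrm (θ₁ + θ₂) (fun x => f x * g x) ≤ nrm θ₁ f * nrm θ₂ g := by
  have : ENNReal.HolderTriple (ENNReal.ofReal θ₁)⁻¹ (ENNReal.ofReal θ₂)⁻¹
      (ENNReal.ofReal (θ₁ + θ₂))⁻¹ :=
    ⟨by rw [inv_inv, inv_inv, inv_inv, ENNReal.ofReal_add h₁ h₂]⟩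
  have := eLpNorm_le_eLpNorm_mul_eLpNorm'_of_norm hf hg (fun a b => a * b) 1
    (.of_forall fun x => by simp) (hpqr := this)
  simpa [nrm] using this

theorem nrm_prod_le {ι : Type*} (s : Finset ι) (θ : ι → ℝ) (f : ι → Euc d → ℝ)
    (hθ : ∀ i ∈ s, 0 ≤ θ i) (hf : ∀ i ∈ s, AEStronglyMeasurable (f i)) :
    nrm (∑ i ∈ s, θ i) (fun x => ∏ i ∈ s, f i x) ≤ ∏ i ∈ s, nrm (θ i) (f i) := by
  classical
  induction s using Finset.induction_on with
  | empty => simpa using nrm_zero_le (d := d) (f := fun _ => 1) (H := 1) (by simp) (by simp)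
  | insert a s ha ih =>
    simp only [Finset.sum_insert ha, Finset.prod_insert ha]
    have hf' : ∀ i ∈ s, AEStronglyMeasurable (f i) := fun i hi => hf i (by simp [hi])
    have hθ' : ∀ i ∈ s, 0 ≤ θ i := fun i hi => hθ i (by simp [hi])
    refine (nrm_mul_le (hθ a (by simp)) (Finset.sum_nonneg hθ') (hf a (by simp))
      (Finset.aestronglyMeasurable_fun_prod s hf')).trans ?_
    gcongr
    exact ih hθ' hf'

theorem nrm_rpow {θ q : ℝ} (hq : 0 < q) {f : Euc d → ℝ} (hf : ∀ x, 0 ≤ f x) :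
    nrm (q * θ) (fun x => f x ^ q) = nrm θ f ^ q := by
  have h := eLpNorm_norm_rpow (μ := volume) (p := (ENNReal.ofReal (q * θ))⁻¹) f hq
  have e : (ENNReal.ofReal (q * θ))⁻¹ * ENNReal.ofReal q = (ENNReal.ofReal θ)⁻¹ := by
    rw [ENNReal.ofReal_mul hq.le, ENNReal.mul_inv (by simp [hq]) (by simp), mul_right_comm,
      ENNReal.inv_mul_cancel (by simpa using hq) (by simp), one_mul]
  rw [e] at h
  unfold nrm
  rw [← h]
  congr 1
  funext x
  rw [Real.norm_of_nonneg (hf x)]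

theorem nrm_interpolate_le {l θ₁ θ₂ : ℝ} (hl : 0 < l) (hl1 : l < 1) (h₁ : 0 ≤ θ₁) (h₂ : 0 ≤ θ₂)
    {f g : Euc d → ℝ} (hf : Continuous f) (hg : Continuous g)
    (hf0 : ∀ x, 0 ≤ f x) (hg0 : ∀ x, 0 ≤ g x) :
    nrm (l * θ₁ + (1 - l) * θ₂) (fun x => f x ^ l * g x ^ (1 - l)) ≤ nrm θ₁ f + nrm θ₂ g := by
  have hl2 : 0 < 1 - l := by linarith
  refine (nrm_mul_le (by positivity) (by positivity)
    (hf.rpow_const fun _ => Or.inr hl.le).aestronglyMeasurable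
    (hg.rpow_const fun _ => Or.inr hl2.le).aestronglyMeasurable).trans ?_
  rw [nrm_rpow hl hf0, nrm_rpow hl2 hg0]
  calc nrm θ₁ f ^ l * nrm θ₂ g ^ (1 - l)
      ≤ (nrm θ₁ f + nrm θ₂ g) ^ l * (nrm θ₁ f + nrm θ₂ g) ^ (1 - l) := by
        gcongr <;> simp
    _ = _ := by rw [← ENNReal.rpow_add_of_nonneg _ _ hl.le hl2.le]; simp

theorem nrm_wt_mul_norm_lt_top (a θ : ℝ) (f : 𝓢(Euc d, ℂ)) :
    nrm θ (fun x => wt a x * ‖f x‖) < ∞ :=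
  (memLp_wt_mul_norm a f _).2

theorem nrm_wt_lineDeriv_sq_le (f : 𝓢(Euc d, ℂ)) (v : Euc d) (hv : ‖v‖ ≤ 1)
    {a a₀ a₂ θ θ₀ θ₂ : ℝ} (ha : a₀ + a₂ = 2 * a) (hθ : θ₀ + θ₂ = 2 * θ) (h0 : 0 < θ)
    (h1 : θ < 1 / 2) (hθ₀ : 0 ≤ θ₀) (hθ₂ : 0 ≤ θ₂) :
    nrm θ (fun x => wt a x * ‖∂_{v} f x‖) ^ 2 ≤
      ENNReal.ofReal (1 / θ - 1) * (nrm θ₀ (fun x => wt a₀ x * ‖f x‖) *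
        nrm θ₂ (fun x => wt a₂ x * ‖∂_{v} (∂_{v} f) x‖)) +
      ENNReal.ofReal (|a| / θ) * (nrm θ (fun x => wt (a - 1) x * ‖f x‖) *
        nrm θ (fun x => wt a x * ‖∂_{v} f x‖)) := by
  set q := 1 / θ - 2 with hq
  have hθq : (q + 2) * θ = 1 := by rw [hq]; field_simp; ring
  have hq0 : 0 < q := by
    have : 2 < 1 / θ := by rw [lt_div_iff₀ h0]; linarith
    linarith
  have hap : |a * (q + 2)| = |a| / θ := by
    rw [abs_mul, abs_of_pos (by linarith : 0 < q + 2), hq]; field_simp; ring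
  have hqe : 1 / θ - 1 = 1 + q := by rw [hq]; ring
  rw [hqe, ← hap]
  set G : Euc d → ℝ := fun x => wt a x * ‖∂_{v} f x‖ with hG
  set A : Euc d → ℝ := fun x => wt a₀ x * ‖f x‖ with hA
  set B : Euc d → ℝ := fun x => wt a₂ x * ‖∂_{v} (∂_{v} f) x‖ with hB
  set M : Euc d → ℝ := fun x => wt (a - 1) x * ‖f x‖ with hM
  have hG0 (x) : 0 ≤ G x := mul_nonneg (wt_nonneg _ _) (norm_nonneg _)
  have hA0 (x) : 0 ≤ A x := mul_nonneg (wt_nonneg _ _) (norm_nonneg _)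
  have hB0 (x) : 0 ≤ B x := mul_nonneg (wt_nonneg _ _) (norm_nonneg _)
  have hM0 (x) : 0 ≤ M x := mul_nonneg (wt_nonneg _ _) (norm_nonneg _)
  have hGc : Continuous G := (continuous_wt _).mul (∂_{v} f).continuous.norm
  have hAc : Continuous A := (continuous_wt _).mul f.continuous.norm
  have hBc : Continuous B := (continuous_wt _).mul (∂_{v} (∂_{v} f)).continuous.norm
  have hMc : Continuous M := (continuous_wt _).mul f.continuous.norm
  set n := nrm θ G with hn
  have hn_top : n ≠ ∞ := (nrm_wt_mul_norm_lt_top a θ (∂_{v} f)).ne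
  rcases eq_or_ne n 0 with hn0 | hn0
  · simp [hn0]
  have key := lintegral_wt_mul_norm_lineDeriv_rpow_le f v hv (a * (q + 2)) hq0
  have e0 : ∫⁻ x, ENNReal.ofReal (wt (a * (q + 2)) x * ‖∂_{v} f x‖ ^ (q + 2)) = n ^ (q + 2) := by
    rw [hn, ← nrm_rpow (by linarith) hG0, hθq, nrm_one fun x => Real.rpow_nonneg (hG0 x) _]
    refine lintegral_congr fun x => ?_
    rw [hG, Real.mul_rpow (wt_nonneg _ _) (norm_nonneg _), wt_rpow]
  have hw (x : Euc d) : wt (a * (q + 2)) x = wt a x ^ q * (wt a₀ x * wt a₂ x) := by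
    rw [wt_rpow, ← wt_add, ← wt_add]; congr 1; rw [ha]; ring
  have hw' (x : Euc d) : wt (a * (q + 2) - 1) x = wt a x ^ (q + 1) * wt (a - 1) x := by
    rw [wt_rpow, ← wt_add]; congr 1; ring
  have e1 : ∫⁻ x, ENNReal.ofReal ((1 + q) * (wt (a * (q + 2)) x * ‖∂_{v} f x‖ ^ q *
      ‖∂_{v} (∂_{v} f) x‖ * ‖f x‖) + |a * (q + 2)| * (wt (a * (q + 2) - 1) x *
        ‖∂_{v} f x‖ ^ (q + 1) * ‖f x‖)) =
      ENNReal.ofReal (1 + q) * nrm 1 (fun x => G x ^ q * (A x * B x)) +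
        ENNReal.ofReal |a * (q + 2)| * nrm 1 (fun x => G x ^ (q + 1) * M x) := by
    rw [nrm_one fun x => mul_nonneg (Real.rpow_nonneg (hG0 x) _) (mul_nonneg (hA0 x) (hB0 x)),
      nrm_one fun x => mul_nonneg (Real.rpow_nonneg (hG0 x) _) (hM0 x),
      ← lintegral_const_mul' _ _ ENNReal.ofReal_ne_top,
      ← lintegral_const_mul' _ _ ENNReal.ofReal_ne_top, ← lintegral_add_left]
    · refine lintegral_congr fun x => ?_
      rw [← ENNReal.ofReal_mul (by linarith), ← ENNReal.ofReal_mul (abs_nonneg _),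
        ← ENNReal.ofReal_add]
      · congr 1
        simp only [hG, hA, hB, hM]
        rw [Real.mul_rpow (wt_nonneg _ _) (norm_nonneg _),
          Real.mul_rpow (wt_nonneg _ _) (norm_nonneg _), hw, hw']
        ring
      · exact mul_nonneg (by linarith)
          (mul_nonneg (Real.rpow_nonneg (hG0 x) _) (mul_nonneg (hA0 x) (hB0 x)))
      · exact mul_nonneg (abs_nonneg _) (mul_nonneg (Real.rpow_nonneg (hG0 x) _) (hM0 x))
    · have : Continuous fun x => G x ^ q := hGc.rpow_const fun _ => Or.inr hq0.le
      fun_prop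
  have hGq (r : ℝ) (hr : 0 < r) : AEStronglyMeasurable fun x => G x ^ r :=
    (hGc.rpow_const fun _ => Or.inr hr.le).aestronglyMeasurable
  have b1 : nrm 1 (fun x => G x ^ q * (A x * B x)) ≤ n ^ q * (nrm θ₀ A * nrm θ₂ B) := by
    have e : (1 : ℝ) = q * θ + (θ₀ + θ₂) := by rw [hθ]; linarith
    rw [e, hn, ← nrm_rpow hq0 hG0]
    refine (nrm_mul_le (by positivity) (by positivity) (hGq q hq0)
      (hAc.mul hBc).aestronglyMeasurable).trans ?_
    gcongr
    exact nrm_mul_le hθ₀ hθ₂ hAc.aestronglyMeasurable hBc.aestronglyMeasurable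
  have b2 : nrm 1 (fun x => G x ^ (q + 1) * M x) ≤ n ^ (q + 1) * nrm θ M := by
    have e : (1 : ℝ) = (q + 1) * θ + θ := by linarith
    have hq' : 0 < q + 1 := by linarith
    generalize q + 1 = r at e hq'
    rw [e, hn, ← nrm_rpow hq' hG0]
    exact nrm_mul_le (by positivity) h0.le (hGq _ hq') hMc.aestronglyMeasurable
  rw [e0, e1] at key
  have hq2 : n ^ (q + 2) = n ^ q * n ^ 2 := by
    rw [ENNReal.rpow_add _ _ hn0 hn_top, ENNReal.rpow_two]
  have hq1 : n ^ (q + 1) = n ^ q * n := by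
    rw [ENNReal.rpow_add _ _ hn0 hn_top, ENNReal.rpow_one]
  have hnq0 : n ^ q ≠ 0 := (ENNReal.rpow_pos (pos_iff_ne_zero.2 hn0) hn_top).ne'
  have hnqt : n ^ q ≠ ∞ := ENNReal.rpow_ne_top_of_nonneg hq0.le hn_top
  rw [← ENNReal.mul_le_mul_iff_right hnq0 hnqt, ← hq2]
  refine key.trans ?_
  calc _ ≤ ENNReal.ofReal (1 + q) * (n ^ q * (nrm θ₀ A * nrm θ₂ B)) +
        ENNReal.ofReal |a * (q + 2)| * (n ^ (q + 1) * nrm θ M) := by gcongr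
    _ = _ := by rw [hq1]; ring

end

/-- An abstract interpolation: a sequence that is almost log-convex is controlled by its ends. -/
theorem exists_forall_le_mul_of_sq_le (c : ℝ) (hc : 0 ≤ c) (k : ℕ) :
    ∃ K : ℝ, 1 ≤ K ∧ ∀ (N : ℕ → ℝ) (H : ℝ), 0 ≤ H → (∀ i, 0 ≤ N i) → N 0 ≤ H → N k ≤ H →
      (∀ i, i + 1 < k → N (i + 1) ^ 2 ≤ c * (N i * N (i + 2)) + c * ((H + N i) * N (i + 1))) →
      ∀ i ≤ k, N i ≤ K * H := by
  have step (i : ℕ) (ε : ℝ) (hε : 0 < ε) : ∃ b : ℝ, 0 < b ∧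
      ∀ (N : ℕ → ℝ) (H : ℝ), 0 ≤ H → (∀ i, 0 ≤ N i) → N 0 ≤ H →
      (∀ i, i + 1 < k → N (i + 1) ^ 2 ≤ c * (N i * N (i + 2)) + c * ((H + N i) * N (i + 1))) →
      i < k → N i ≤ ε * N (i + 1) + b * H := by
    induction i generalizing ε with
    | zero =>
      refine ⟨1, one_pos, fun N H hH hN h0 _ _ => ?_⟩
      have := mul_nonneg hε.le (hN 1)
      simp only [zero_add]
      linarith
    | succ i ih =>
      obtain ⟨b, hb, hi⟩ := ih (min ε 1 / (8 * (c + 1))) (by positivity)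
      set η := min ε 1 / (8 * (c + 1)) with hη
      have hη0 : 0 < η := by positivity
      have hηε : c * η ≤ ε / 8 := by
        rw [hη, ← mul_div_assoc, div_le_div_iff₀ (by positivity) (by positivity)]
        have := min_le_left ε 1
        have := min_le_right ε 1
        nlinarith [mul_nonneg hc hε.le]
      have hη1 : c * η ≤ 1 / 8 := by
        rw [hη, ← mul_div_assoc, div_le_div_iff₀ (by positivity) (by positivity)]
        have := min_le_right ε 1
        nlinarith
      refine ⟨8 * c * b / ε + 8 * c * (1 + b) + 1, by positivity, fun N H hH hN h0 hc2 hik => ?_⟩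
      set b' := 8 * c * b / ε + 8 * c * (1 + b) + 1 with hb'
      have h1 := hi N H hH hN h0 hc2 (by omega)
      have h2 := hc2 i hik
      set x := N (i + 1)
      set y := N (i + 2)
      have hx : 0 ≤ x := hN _
      have hy : 0 ≤ y := hN _
      by_contra! hlt
      have hx0 : 0 < x := lt_of_le_of_lt (by positivity) hlt
      have hxy : ε * y ≤ x := by nlinarith [mul_nonneg (by positivity : 0 ≤ b') hH]
      have hxH : b' * H ≤ x := by nlinarith [mul_nonneg hε.le hy]
      have t1 : c * η * x * y ≤ x ^ 2 / 8 := by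
        have : c * η * y ≤ x / 8 := by nlinarith
        nlinarith
      have t2 : c * b * H * y ≤ x ^ 2 / 8 := by
        have e1 : 8 * c * b / ε * H ≤ x := by
          refine le_trans ?_ hxH
          gcongr
          rw [hb']
          have : 0 ≤ 8 * c * (1 + b) := by positivity
          linarith
        have e2 : 8 * c * b * H ≤ ε * x := by
          rw [div_mul_eq_mul_div, div_le_iff₀ hε] at e1; linarith
        have : 8 * c * b * H * y ≤ ε * x * y := by gcongr
        nlinarith
      have t3 : c * (1 + b) * H * x ≤ x ^ 2 / 8 := by
        have e1 : 8 * c * (1 + b) * H ≤ x := by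
          refine le_trans ?_ hxH
          gcongr
          rw [hb']
          have : 0 ≤ 8 * c * b / ε := by positivity
          linarith
        nlinarith
      have t4 : c * η * x * x ≤ x ^ 2 / 8 := by nlinarith [sq_nonneg x]
      have h3 : x ^ 2 ≤ c * ((η * x + b * H) * y) + c * ((H + (η * x + b * H)) * x) := by
        refine h2.trans ?_
        gcongr
      nlinarith [sq_pos_of_pos hx0]
  choose b hb hstep using fun i => step i 1 one_pos
  let S : ℝ := ∑ i ∈ Finset.range k, b i
  refine ⟨1 + S, le_add_of_nonneg_right (Finset.sum_nonneg fun i _ => (hb i).le),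
    fun N H hH hN h0 hk hc2 i hi => ?_⟩
  have desc (l : ℕ) (hl : l ≤ k) : N (k - l) ≤ H + (∑ i ∈ Finset.Ico (k - l) k, b i) * H := by
    induction l with
    | zero => simpa using hk
    | succ l ih =>
      have h1 := ih (by omega)
      have h2 := hstep (k - (l + 1)) N H hH hN h0 hc2 (by omega)
      rw [show k - (l + 1) + 1 = k - l by omega, one_mul] at h2
      rw [Finset.sum_eq_sum_Ico_succ_bot (by omega), show k - (l + 1) + 1 = k - l by omega]
      linarith
  have h1 := desc (k - i) (by omega)
  rw [show k - (k - i) = i by omega] at h1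
  have h2 : ∑ j ∈ Finset.Ico i k, b j ≤ S :=
    Finset.sum_le_sum_of_subset_of_nonneg (fun j hj => by simp at hj ⊢; omega)
      fun j _ _ => (hb j).le
  nlinarith

section
variable {d : ℕ}

/-- Iterated partial derivative along the standard basis. -/
def pderiv {i : ℕ} (t : Fin i → Fin d) (h : 𝓢(Euc d, ℂ)) : 𝓢(Euc d, ℂ) :=
  ∂^{fun j => EuclideanSpace.single (t j) (1 : ℝ)} h

theorem norm_pderiv_apply_le {i : ℕ} (t : Fin i → Fin d) (h : 𝓢(Euc d, ℂ)) (x : Euc d) :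
    ‖pderiv t h x‖ ≤ ‖iteratedFDeriv ℝ i h x‖ := by
  unfold pderiv
  rw [iteratedLineDerivOp_eq_iteratedFDeriv]
  refine (ContinuousMultilinearMap.le_opNorm _ _).trans ?_
  simp

theorem norm_iteratedFDeriv_le_sum_pderiv (i : ℕ) (h : 𝓢(Euc d, ℂ)) (x : Euc d) :
    ‖iteratedFDeriv ℝ i h x‖ ≤ ∑ t : Fin i → Fin d, ‖pderiv t h x‖ := by
  refine ContinuousMultilinearMap.opNorm_le_bound (Finset.sum_nonneg fun _ _ => norm_nonneg _)
    fun v => ?_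
  have hv : v = fun j => ∑ l : Fin d, v j l • EuclideanSpace.single l (1 : ℝ) := by
    funext j
    ext l
    simp [Finset.sum_apply, Pi.single_apply]
  conv_lhs => rw [hv]
  rw [ContinuousMultilinearMap.map_sum, Finset.sum_mul]
  refine (norm_sum_le _ _).trans (Finset.sum_le_sum fun t _ => ?_)
  rw [ContinuousMultilinearMap.map_smul_univ, norm_smul, mul_comm, norm_prod]
  unfold pderiv
  rw [iteratedLineDerivOp_eq_iteratedFDeriv]
  gcongr with j
  exact PiLp.norm_apply_le (v j) (t j)

theorem nrm_sum_le {ι : Type*} (s : Finset ι) {θ : ℝ} (hθ : θ ≤ 1) (f : ι → Euc d → ℝ)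
    (hf : ∀ i ∈ s, AEStronglyMeasurable (f i)) :
    nrm θ (fun x => ∑ i ∈ s, f i x) ≤ ∑ i ∈ s, nrm θ (f i) := by
  have h := eLpNorm_sum_le (μ := volume) (p := (ENNReal.ofReal θ)⁻¹) (f := f) (s := s) hf
    (by simpa using hθ)
  unfold nrm
  convert h using 2
  funext x
  simp

theorem wt_mul_norm_summand_le (m i : ℕ) (hi : i ≤ m) (h : 𝓢(Euc d, ℂ)) :
    nrm (1 / 2) (fun x => wt (m - i) x * ‖iteratedFDeriv ℝ i h x‖) ≤ HmmNorm d m h := by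
  rw [nrm_half]
  exact Finset.single_le_sum (f := fun i : ℕ => eLpNorm (fun x : Euc d =>
    wt (m - i) x * ‖iteratedFDeriv ℝ i h x‖) 2 volume) (fun _ _ => zero_le)
    (Finset.mem_range.2 (by omega))

theorem HmmNorm_lt_top (m : ℕ) (h : 𝓢(Euc d, ℂ)) : HmmNorm d m h < ∞ := by
  refine ENNReal.sum_lt_top.2 fun i _ => ?_
  change eLpNorm (fun x : Euc d => wt (m - i) x * ‖iteratedFDeriv ℝ i h x‖) 2 volume < ∞
  rw [← nrm_half]
  refine lt_of_le_of_lt (nrm_mono (g := fun x => ∑ t : Fin i → Fin d,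
    wt (m - i) x * ‖pderiv t h x‖) (fun x => mul_nonneg (wt_nonneg _ _) (norm_nonneg _))
    fun x => ?_) (lt_of_le_of_lt (nrm_sum_le _ (by norm_num) _ fun t _ => ?_)
      (ENNReal.sum_lt_top.2 fun t _ => nrm_wt_mul_norm_lt_top _ _ _))
  · rw [← Finset.mul_sum]
    exact mul_le_mul_of_nonneg_left (norm_iteratedFDeriv_le_sum_pderiv i h x) (wt_nonneg _ _)
  · exact ((continuous_wt _).mul (pderiv t h).continuous.norm).aestronglyMeasurable

/-- The weight exponents, interpolating linearly between `s` at `0` and `m - k` at `k`. -/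
def wtExp (s : ℝ) (m k i : ℕ) : ℝ := s + i * (m - k - s) / k

theorem wtExp_nonneg {s : ℝ} {m k i : ℕ} (hs : 0 ≤ s) (hk : 1 ≤ k) (hkm : k ≤ m) (hik : i ≤ k) :
    0 ≤ wtExp s m k i := by
  have hk' : (0 : ℝ) < k := by exact_mod_cast hk
  have h1 : (k : ℝ) ≤ m := by exact_mod_cast hkm
  have h2 : (i : ℝ) ≤ k := by exact_mod_cast hik
  have h3 : (0 : ℝ) ≤ i := by positivity
  have e : wtExp s m k i = (s * (k - i) + i * (m - k)) / k := by
    unfold wtExp; field_simp; ring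
  rw [e]
  have := mul_nonneg hs (by linarith : (0 : ℝ) ≤ k - i)
  have := mul_nonneg h3 (by linarith : (0 : ℝ) ≤ m - k)
  positivity

theorem wtExp_le {s : ℝ} {m k i : ℕ} (hs : s ≤ m) (hk : 1 ≤ k) (hik : i ≤ k) :
    wtExp s m k i ≤ m := by
  have hk' : (0 : ℝ) < k := by exact_mod_cast hk
  have h2 : (i : ℝ) ≤ k := by exact_mod_cast hik
  have h3 : (0 : ℝ) ≤ i := by positivity
  unfold wtExp
  rw [← le_sub_iff_add_le', div_le_iff₀ hk']
  nlinarith [mul_nonneg (by linarith : (0 : ℝ) ≤ k - i) (by linarith : (0 : ℝ) ≤ m - s)]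

theorem exists_forall_nrm_wt_iteratedFDeriv_le (d m k : ℕ) (hd : 1 ≤ d) (s : ℝ) (hs : 0 ≤ s)
    (hsm : s + d / 2 + 1 ≤ m) (hk : 1 ≤ k) (hkm : k ≤ m) :
    ∃ K : ℝ, 1 ≤ K ∧ ∀ h : 𝓢(Euc d, ℂ), ∀ i ≤ k,
      nrm (i / (2 * k)) (fun x => wt (wtExp s m k i) x * ‖iteratedFDeriv ℝ i h x‖) ≤
        ENNReal.ofReal K * HmmNorm d m h := by
  have hk' : (0 : ℝ) < k := by exact_mod_cast hk
  have hsm' : s ≤ m := by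
    have : (0 : ℝ) ≤ d := by positivity
    linarith
  set c : ℝ := 2 * k * (m + 1) with hc
  obtain ⟨K, hK1, hK⟩ := exists_forall_le_mul_of_sq_le c (by positivity) k
  have hne : Nonempty (Fin d) := ⟨⟨0, hd⟩⟩
  refine ⟨d ^ k * K, ?_, fun h => ?_⟩
  · have : (1 : ℝ) ≤ d ^ k := one_le_pow₀ (by exact_mod_cast hd)
    nlinarith
  let X (i : ℕ) (t : Fin i → Fin d) : ℝ≥0∞ :=
    nrm (i / (2 * k)) (fun x => wt (wtExp s m k i) x * ‖pderiv t h x‖)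
  let n (i : ℕ) : ℝ≥0∞ := ⨆ t, X i t
  set H := HmmNorm d m h with hH
  have hXn (i : ℕ) (t : Fin i → Fin d) : X i t ≤ n i := le_iSup (X i) t
  have hn_att (i : ℕ) : ∃ t, X i t = n i := exists_eq_ciSup_of_finite
  have hn_top (i : ℕ) : n i ≠ ∞ := by
    obtain ⟨t, ht⟩ := hn_att i
    rw [← ht]
    exact (nrm_wt_mul_norm_lt_top _ _ _).ne
  have hH_top : H ≠ ∞ := (HmmNorm_lt_top m h).ne
  have h0 : n 0 ≤ H := by
    refine iSup_le fun t => ?_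
    simp only [X, Nat.cast_zero, zero_div]
    refine nrm_zero_le (fun x => mul_nonneg (wt_nonneg _ _) (norm_nonneg _)) fun x => ?_
    have e : wtExp s m k 0 = s := by simp [wtExp]
    have e2 : pderiv t h = h := by simp [pderiv]
    rw [e, e2, ENNReal.ofReal_mul (wt_nonneg _ _), ofReal_norm]
    exact ofReal_wt_mul_enorm_apply_le d m hd s hs hsm h x
  have hnk : n k ≤ H := by
    refine iSup_le fun t => le_trans ?_ (wt_mul_norm_summand_le m k hkm h)
    have e : wtExp s m k k = m - k := by unfold wtExp; field_simp; ring
    have e2 : (k : ℝ) / (2 * k) = 1 / 2 := by field_simp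
    simp only [X, e, e2]
    exact nrm_mono (fun x => mul_nonneg (wt_nonneg _ _) (norm_nonneg _)) fun x =>
      mul_le_mul_of_nonneg_left (norm_pderiv_apply_le t h x) (wt_nonneg _ _)
  have hstep (i : ℕ) (hi : i + 1 < k) : n (i + 1) ^ 2 ≤
      ENNReal.ofReal c * (n i * n (i + 2)) + ENNReal.ofReal c * ((H + n i) * n (i + 1)) := by
    obtain ⟨t, ht⟩ := hn_att (i + 1)
    set f := pderiv (Fin.tail t) h with hf
    set v : Euc d := EuclideanSpace.single (t 0) (1 : ℝ) with hv
    have hψ : pderiv t h = ∂_{v} f := rfl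
    have hψ2 : ∂_{v} (∂_{v} f) = pderiv (Fin.cons (t 0) t : Fin (i + 2) → Fin d) h := rfl
    have hi' : (i : ℝ) + 1 < k := by exact_mod_cast hi
    have hi0 : (0 : ℝ) ≤ i := by positivity
    set θ : ℝ := (i + 1) / (2 * k) with hθ
    have hθ0 : 0 < θ := by positivity
    have hθh : θ < 1 / 2 := by
      rw [hθ, div_lt_div_iff₀ (by positivity) (by positivity)]; linarith
    have key := nrm_wt_lineDeriv_sq_le f v (by simp [hv]) (a := wtExp s m k (i + 1))
      (a₀ := wtExp s m k i) (a₂ := wtExp s m k (i + 2)) (θ := θ) (θ₀ := i / (2 * k))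
      (θ₂ := (i + 2) / (2 * k)) (by unfold wtExp; push_cast; ring) (by rw [hθ]; ring) hθ0 hθh
      (by positivity) (by positivity)
    have hM : nrm θ (fun x => wt (wtExp s m k (i + 1) - 1) x * ‖f x‖) ≤ H + n i := by
      set l : ℝ := 1 / (k - i) with hl
      have hki : 1 < (k : ℝ) - i := by linarith
      have hl0 : 0 < l := by positivity
      have hl1 : l < 1 := by rw [hl, div_lt_one (by linarith)]; exact hki
      have eθ : θ = l * (1 / 2) + (1 - l) * (i / (2 * k)) := by
        have : (k : ℝ) - i ≠ 0 := by linarith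
        rw [hθ, hl]; field_simp; ring
      have ea : wtExp s m k (i + 1) = l * (m - k) + (1 - l) * wtExp s m k i := by
        have : (k : ℝ) - i ≠ 0 := by linarith
        unfold wtExp; rw [hl]; push_cast; field_simp; ring
      have hint := nrm_interpolate_le (d := d) hl0 hl1 (θ₁ := 1 / 2) (θ₂ := i / (2 * k))
        (by norm_num) (by positivity)
        (f := fun x => wt (m - i) x * ‖f x‖) (g := fun x => wt (wtExp s m k i) x * ‖f x‖)
        ((continuous_wt _).mul f.continuous.norm) ((continuous_wt _).mul f.continuous.norm)
        (fun x => mul_nonneg (wt_nonneg _ _) (norm_nonneg _))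
        (fun x => mul_nonneg (wt_nonneg _ _) (norm_nonneg _))
      rw [← eθ] at hint
      refine (nrm_mono (fun x => mul_nonneg (wt_nonneg _ _) (norm_nonneg _)) fun x => ?_).trans
        (hint.trans (add_le_add ?_ (hXn i (Fin.tail t))))
      · rw [Real.mul_rpow (wt_nonneg _ _) (norm_nonneg _),
          Real.mul_rpow (wt_nonneg _ _) (norm_nonneg _), wt_rpow, wt_rpow, mul_mul_mul_comm,
          ← wt_add, ← Real.rpow_add' (norm_nonneg _) (by simp), add_sub_cancel, Real.rpow_one]
        refine mul_le_mul_of_nonneg_right (wt_le_wt ?_ x) (norm_nonneg _)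
        rw [ea]
        nlinarith
      · refine le_trans ?_ (wt_mul_norm_summand_le m i (by omega) h)
        exact nrm_mono (fun x => mul_nonneg (wt_nonneg _ _) (norm_nonneg _)) fun x =>
          mul_le_mul_of_nonneg_left (norm_pderiv_apply_le _ h x) (wt_nonneg _ _)
    have hX1 : nrm θ (fun x => wt (wtExp s m k (i + 1)) x * ‖∂_{v} f x‖) = n (i + 1) := by
      rw [← ht, ← hψ]; simp only [X, hθ]; push_cast; rfl
    have hX2 : nrm ((i + 2) / (2 * k)) (fun x => wt (wtExp s m k (i + 2)) x *
        ‖∂_{v} (∂_{v} f) x‖) ≤ n (i + 2) := by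
      refine le_trans (le_of_eq ?_) (hXn (i + 2) (Fin.cons (t 0) t))
      rw [hψ2]; simp only [X]; push_cast; rfl
    rw [hX1] at key
    refine key.trans ?_
    have hθinv : 1 / θ ≤ 2 * k := by
      rw [hθ, one_div_div]
      exact div_le_self (by positivity) (by linarith)
    have hc1 : 1 / θ - 1 ≤ c := by
      have : (0 : ℝ) ≤ m := by positivity
      rw [hc]; nlinarith
    have hc2 : |wtExp s m k (i + 1)| / θ ≤ c := by
      rw [abs_of_nonneg (wtExp_nonneg hs hk hkm hi.le), div_eq_mul_one_div, hc]
      have := wtExp_le hsm' hk hi.le (i := i + 1)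
      have h0 : (0 : ℝ) ≤ m := by positivity
      calc _ ≤ (m : ℝ) * (2 * k) := by gcongr
        _ ≤ _ := by nlinarith
    gcongr
    exact hXn i (Fin.tail t)
  have hfin := hK (fun i => (n i).toReal) H.toReal ENNReal.toReal_nonneg
    (fun _ => ENNReal.toReal_nonneg) (ENNReal.toReal_mono hH_top h0)
    (ENNReal.toReal_mono hH_top hnk) fun i hi => by
      have h1 := ENNReal.toReal_mono (by finiteness [hn_top i, hn_top (i+1), hn_top (i+2), hH_top])
        (hstep i hi)
      have hc0 : 0 ≤ c := by positivity
      rw [ENNReal.toReal_add (by finiteness [hn_top i, hn_top (i+2)])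
        (by finiteness [hn_top i, hn_top (i+1), hH_top])] at h1
      simpa only [ENNReal.toReal_mul, ENNReal.toReal_pow, ENNReal.toReal_ofReal hc0,
        ENNReal.toReal_add hH_top (hn_top i)] using h1
  intro i hi
  have hni : n i ≤ ENNReal.ofReal K * H := by
    rw [← ENNReal.ofReal_toReal (hn_top i), ← ENNReal.ofReal_toReal hH_top,
      ← ENNReal.ofReal_mul (by linarith)]
    exact ENNReal.ofReal_le_ofReal (hfin i hi)
  calc _ ≤ nrm (i / (2 * k)) (fun x => ∑ t : Fin i → Fin d,
          wt (wtExp s m k i) x * ‖pderiv t h x‖) := by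
        refine nrm_mono (fun x => mul_nonneg (wt_nonneg _ _) (norm_nonneg _)) fun x => ?_
        rw [← Finset.mul_sum]
        exact mul_le_mul_of_nonneg_left (norm_iteratedFDeriv_le_sum_pderiv i h x) (wt_nonneg _ _)
    _ ≤ ∑ t : Fin i → Fin d, X i t := by
        refine nrm_sum_le _ ?_ _ fun t _ =>
          ((continuous_wt _).mul (pderiv t h).continuous.norm).aestronglyMeasurable
        have : (i : ℝ) ≤ k := by exact_mod_cast hi
        rw [div_le_one (by positivity)]; linarith
    _ ≤ ∑ t : Fin i → Fin d, n i := Finset.sum_le_sum fun t _ => hXn i t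
    _ = (d : ℝ≥0∞) ^ i * n i := by simp
    _ ≤ (d : ℝ≥0∞) ^ k * (ENNReal.ofReal K * H) := by
        gcongr
        exact_mod_cast hd
    _ = _ := by
        rw [ENNReal.ofReal_mul (by positivity), ENNReal.ofReal_pow (by positivity),
          ENNReal.ofReal_natCast]
        ring

end

theorem Finset.sum_sym_countPerms {ι : Type*} [DecidableEq ι] (s : Finset ι) (n : ℕ) :
    ∑ p ∈ s.sym n, ((p : Multiset ι).countPerms : ℝ) = (s.card : ℝ) ^ n := by
  simpa using (Finset.sum_pow (fun _ : ι => (1 : ℝ)) (s := s) n).symm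

theorem Sym.sum_count_eq {ι : Type*} [Fintype ι] [DecidableEq ι] {n : ℕ} (p : Sym ι n) :
    ∑ i, (p : Multiset ι).count i = n := by
  rw [Multiset.sum_count_eq_card fun _ _ => Finset.mem_univ _]
  exact p.2

section WeightDeriv
variable {E : Type*} [NormedAddCommGroup E] [InnerProductSpace ℝ E]

theorem contDiff_wt (a : ℝ) {n : WithTop ℕ∞} : ContDiff ℝ n (wt a : E → ℝ) := by
  unfold wt
  exact (contDiff_const.add (contDiff_norm_sq ℝ)).rpow_const_of_ne fun x => by positivity

theorem fderiv_wt (a : ℝ) :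
    fderiv ℝ (wt a : E → ℝ) = fun x => a • (wt (a - 2) x • innerSL ℝ x) := by
  funext x
  have h0 : HasFDerivAt (fun x : E => 1 + ‖x‖ ^ 2) (2 • innerSL ℝ x) x :=
    (hasStrictFDerivAt_norm_sq x).hasFDerivAt.const_add 1
  have h := h0.rpow_const (p := a / 2) (Or.inl (by positivity))
  have e : (1 + ‖x‖ ^ 2) ^ (a / 2 - 1) = wt (a - 2) x := by unfold wt; congr 1; ring
  rw [e] at h
  refine h.fderiv.trans ?_
  ext w
  simp
  ring

theorem norm_iteratedFDeriv_innerSL_le (n : ℕ) (x : E) :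
    ‖iteratedFDeriv ℝ n (fun x : E => innerSL ℝ x) x‖ ≤ wt 1 x := by
  have h1 : 1 ≤ wt 1 x := by
    simpa [wt_zero] using wt_le_wt zero_le_one x
  have hf : fderiv ℝ (fun x : E => innerSL ℝ x) = fun _ => innerSL ℝ := by
    funext y; exact (innerSL ℝ (E := E)).fderiv
  match n with
  | 0 => simpa using norm_le_wt_one x
  | 1 =>
    rw [← norm_iteratedFDeriv_fderiv, hf]
    simpa using (norm_innerSL_le ℝ (E := E)).trans h1
  | n + 2 =>
    rw [← norm_iteratedFDeriv_fderiv, hf, iteratedFDeriv_const_of_ne (by omega)]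
    simpa using wt_nonneg 1 x

theorem exists_forall_norm_iteratedFDeriv_wt_le (n : ℕ) :
    ∃ c : ℝ, 0 ≤ c ∧ ∀ i ≤ n, ∀ (a : ℝ) (x : E),
      ‖iteratedFDeriv ℝ i (wt a) x‖ ≤ c * (1 + |a|) ^ i * wt a x := by
  induction n with
  | zero =>
    refine ⟨1, zero_le_one, fun i hi a x => ?_⟩
    obtain rfl : i = 0 := by omega
    simp [abs_of_pos (wt_pos a x)]
  | succ n ih =>
    obtain ⟨c, hc, h⟩ := ih
    refine ⟨max c (2 ^ n * (c * 3 ^ n)), hc.trans (le_max_left _ _), fun i hi a x => ?_⟩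
    have hw := wt_nonneg a x
    rcases Nat.lt_or_ge i (n + 1) with hi' | hi'
    · refine (h i (by omega) a x).trans ?_
      gcongr
      exact le_max_left _ _
    obtain rfl : i = n + 1 := by omega
    have h3 : 1 + |a - 2| ≤ 3 * (1 + |a|) := by
      have := abs_sub a 2
      rw [abs_two] at this
      linarith [abs_nonneg a]
    have hww : wt (a - 2) x * wt 1 x ≤ wt a x := by
      rw [← wt_add]; exact wt_le_wt (by linarith) x
    have key : ‖iteratedFDeriv ℝ n (fun x : E => wt (a - 2) x • innerSL ℝ x) x‖ ≤
        2 ^ n * (c * 3 ^ n) * (1 + |a|) ^ n * wt a x := by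
      refine (norm_iteratedFDeriv_smul_le (N := n) (contDiff_wt _)
        (innerSL ℝ (E := E)).contDiff x le_rfl).trans ?_
      have e : (2 : ℝ) ^ n = ∑ i ∈ Finset.range (n + 1), (n.choose i : ℝ) := by
        exact_mod_cast (Nat.sum_range_choose n).symm
      rw [e, Finset.sum_mul, Finset.sum_mul, Finset.sum_mul]
      refine Finset.sum_le_sum fun i hi => ?_
      have hi := Finset.mem_range_succ_iff.1 hi
      have hb : (1 + |a - 2|) ^ i ≤ (3 * (1 + |a|)) ^ n :=
        (pow_le_pow_right₀ (by linarith [abs_nonneg (a - 2)]) hi).trans (by gcongr)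
      have hw2 := wt_nonneg (a - 2) x
      have hw3 := wt_nonneg 1 x
      calc _ ≤ (n.choose i : ℝ) * (c * (1 + |a - 2|) ^ i * wt (a - 2) x) * wt 1 x := by
            gcongr
            · exact h i hi _ x
            · exact norm_iteratedFDeriv_innerSL_le _ x
        _ = (n.choose i : ℝ) * c * (1 + |a - 2|) ^ i * (wt (a - 2) x * wt 1 x) := by ring
        _ ≤ (n.choose i : ℝ) * c * (3 * (1 + |a|)) ^ n * wt a x := by gcongr
        _ = _ := by rw [mul_pow]; ring
    have hg : ContDiff ℝ n (fun x : E => wt (a - 2) x • innerSL ℝ x) :=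
      (contDiff_wt _).smul (innerSL ℝ (E := E)).contDiff
    rw [← norm_iteratedFDeriv_fderiv, fderiv_wt]
    rw [iteratedFDeriv_const_smul_apply' hg.contDiffAt, norm_smul, Real.norm_eq_abs]
    calc _ ≤ (1 + |a|) * (2 ^ n * (c * 3 ^ n) * (1 + |a|) ^ n * wt a x) := by
          gcongr; linarith
      _ = 2 ^ n * (c * 3 ^ n) * (1 + |a|) ^ (n + 1) * wt a x := by ring
      _ ≤ _ := by gcongr; exact le_max_right _ _

end WeightDeriv

section PowerEstimate
variable {d : ℕ}

theorem nrm_const_mul_le {θ c : ℝ} (hc : 0 ≤ c) (f : Euc d → ℝ) :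
    nrm θ (fun x => c * f x) ≤ ENNReal.ofReal c * nrm θ f := by
  unfold nrm
  refine (eLpNorm_const_smul_le (c := c) (f := f)).trans ?_
  rw [Real.enorm_of_nonneg hc]

theorem aestronglyMeasurable_wt_mul_norm_iteratedFDeriv (a : ℝ) (n : ℕ) (h : 𝓢(Euc d, ℂ)) :
    AEStronglyMeasurable fun x => wt a x * ‖iteratedFDeriv ℝ n h x‖ :=
  ((continuous_wt a).mul
    ((h.smooth n).continuous_iteratedFDeriv le_rfl).norm).aestronglyMeasurable

theorem sum_wtExp (s : ℝ) (m : ℕ) {n : ℕ} (hn : 1 ≤ n) {ι : Type*} [Fintype ι] (p : ι → ℕ)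
    (hp : ∑ i, p i = n) :
    ∑ i, wtExp s m n (p i) = Fintype.card ι * s + (m - n - s) := by
  have hn' : (n : ℝ) ≠ 0 := by exact_mod_cast (by omega : n ≠ 0)
  have hp' : ∑ i, (p i : ℝ) = n := by exact_mod_cast hp
  unfold wtExp
  rw [Finset.sum_add_distrib, ← Finset.sum_div, ← Finset.sum_mul, hp', mul_div_cancel_left₀ _ hn']
  simp

theorem prod_wt {E ι : Type*} [NormedAddCommGroup E] (s : Finset ι) (a : ι → ℝ) (x : E) :
    ∏ i ∈ s, wt (a i) x = wt (∑ i ∈ s, a i) x := by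
  classical
  induction s using Finset.induction_on with
  | empty => simp [wt_zero]
  | insert i s hi ih => rw [Finset.prod_insert hi, Finset.sum_insert hi, wt_add, ih]

theorem nrm_zero_wt_mul_norm_le {m : ℕ} (hd : 1 ≤ d) {s : ℝ} (hs : 0 ≤ s)
    (hsm : s + d / 2 + 1 ≤ m) (h : 𝓢(Euc d, ℂ)) :
    nrm 0 (fun x => wt s x * ‖iteratedFDeriv ℝ 0 h x‖) ≤ HmmNorm d m h := by
  refine nrm_zero_le (fun x => mul_nonneg (wt_nonneg _ _) (norm_nonneg _)) fun x => ?_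
  rw [ENNReal.ofReal_mul (wt_nonneg _ _), norm_iteratedFDeriv_zero, ofReal_norm]
  exact ofReal_wt_mul_enorm_apply_le d m hd s hs hsm h x

theorem exists_forall_nrm_wt_mul_prod_le (d m n : ℕ) (hd : 1 ≤ d) (s : ℝ) (hs : 0 ≤ s)
    (hsm : s + d / 2 + 1 ≤ m) (hnm : n ≤ m) :
    ∃ K : ℝ, 0 ≤ K ∧ ∀ (j : ℕ) (h : 𝓢(Euc d, ℂ)) (p : Fin j → ℕ) (b : ℝ), 1 ≤ j →
      ∑ i, p i = n → b ≤ m - n + (j - 1) * s →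
      nrm (1 / 2) (fun x => wt b x * ∏ i, ‖iteratedFDeriv ℝ (p i) h x‖) ≤
        ENNReal.ofReal K * HmmNorm d m h ^ j := by
  rcases Nat.eq_zero_or_pos n with rfl | hn
  · refine ⟨1, zero_le_one, fun j h p b hj hp hb => ?_⟩
    obtain ⟨j, rfl⟩ : ∃ k, j = k + 1 := ⟨j - 1, by omega⟩
    obtain rfl : p = fun _ => 0 := by
      funext i
      simpa using (Finset.sum_eq_zero_iff.1 hp) i (Finset.mem_univ i)
    have hb' : b ≤ m + ∑ _i : Fin j, s := by simpa using hb
    set F : Euc d → ℝ := fun x => ∏ _i : Fin j, (wt s x * ‖iteratedFDeriv ℝ 0 h x‖) with hF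
    have e : ∀ x, wt b x * ∏ _i : Fin (j + 1), ‖iteratedFDeriv ℝ 0 h x‖ ≤
        (wt m x * ‖iteratedFDeriv ℝ 0 h x‖) * F x := fun x => by
      simp only [hF, Fin.prod_univ_succ]
      rw [Finset.prod_mul_distrib, prod_wt]
      calc _ ≤ wt (m + ∑ _i : Fin j, s) x *
            (‖iteratedFDeriv ℝ 0 h x‖ * ∏ _i : Fin j, ‖iteratedFDeriv ℝ 0 h x‖) :=
            mul_le_mul_of_nonneg_right (wt_le_wt hb' x) (by positivity)
        _ = _ := by rw [wt_add]; ring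
    have hm := aestronglyMeasurable_wt_mul_norm_iteratedFDeriv s 0 h
    have h1 : nrm 0 F ≤ HmmNorm d m h ^ j := by
      have := nrm_prod_le Finset.univ (fun _ : Fin j => (0 : ℝ))
        (fun _ x => wt s x * ‖iteratedFDeriv ℝ 0 h x‖) (fun _ _ => le_rfl) fun _ _ => hm
      rw [Finset.sum_const_zero] at this
      refine this.trans ((Finset.prod_le_pow_card _ _ _
        fun _ _ => nrm_zero_wt_mul_norm_le hd hs hsm h).trans ?_)
      simp
    refine (nrm_mono (fun x => mul_nonneg (wt_nonneg _ _) (by positivity)) e).trans ?_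
    have h2 := nrm_mul_le (θ₁ := 1 / 2) (θ₂ := 0) (by norm_num) le_rfl
      (aestronglyMeasurable_wt_mul_norm_iteratedFDeriv m 0 h)
      (Finset.aestronglyMeasurable_fun_prod (Finset.univ : Finset (Fin j)) fun _ _ => hm)
    rw [add_zero] at h2
    refine h2.trans ?_
    have h3 := wt_mul_norm_summand_le m 0 (Nat.zero_le m) h
    rw [Nat.cast_zero, sub_zero] at h3
    rw [ENNReal.ofReal_one, one_mul, pow_succ']
    exact mul_le_mul' h3 h1
  · obtain ⟨K, hK1, hK⟩ := exists_forall_nrm_wt_iteratedFDeriv_le d m n hd s hs hsm hn hnm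
    refine ⟨K ^ n, by positivity, fun j h p b hj hp hb => ?_⟩
    have hn' : (0 : ℝ) < n := by exact_mod_cast hn
    have hp' : ∑ i, (p i : ℝ) = n := by exact_mod_cast hp
    have hle : ∀ i, p i ≤ n := fun i => by
      rw [← hp]; exact Finset.single_le_sum (fun _ _ => Nat.zero_le _) (Finset.mem_univ i)
    have e : ∀ x, wt b x * ∏ i, ‖iteratedFDeriv ℝ (p i) h x‖ ≤
        ∏ i, (wt (wtExp s m n (p i)) x * ‖iteratedFDeriv ℝ (p i) h x‖) := fun x => by
      rw [Finset.prod_mul_distrib, prod_wt, sum_wtExp s m hn p hp, Fintype.card_fin]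
      exact mul_le_mul_of_nonneg_right (wt_le_wt (by linarith) x) (by positivity)
    refine (nrm_mono (fun x => mul_nonneg (wt_nonneg _ _) (by positivity)) e).trans ?_
    have h1 := nrm_prod_le Finset.univ (fun i => (p i : ℝ) / (2 * n))
        (fun i x => wt (wtExp s m n (p i)) x * ‖iteratedFDeriv ℝ (p i) h x‖)
        (fun _ _ => by positivity)
        fun i _ => aestronglyMeasurable_wt_mul_norm_iteratedFDeriv _ _ h
    have hhalf : ∑ i, (p i : ℝ) / (2 * n) = 1 / 2 := by
      rw [← Finset.sum_div, hp']; field_simp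
    rw [hhalf] at h1
    refine h1.trans ?_
    have h2 : ∀ i, nrm ((p i : ℝ) / (2 * n))
        (fun x => wt (wtExp s m n (p i)) x * ‖iteratedFDeriv ℝ (p i) h x‖) ≤
        ENNReal.ofReal K ^ p i * HmmNorm d m h := fun i => by
      rcases Nat.eq_zero_or_pos (p i) with h0 | h0
      · have := nrm_zero_wt_mul_norm_le hd hs hsm h
        rw [h0]
        simpa [wtExp] using this
      · refine (hK h (p i) (hle i)).trans ?_
        gcongr
        exact le_self_pow₀ (by simpa using hK1) (by omega)
    refine (Finset.prod_le_prod' fun i _ => h2 i).trans ?_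
    rw [Finset.prod_mul_distrib, Finset.prod_pow_eq_pow_sum, hp,
      ENNReal.ofReal_pow (by linarith)]
    simp

end PowerEstimate

theorem nrm_wt_mul_norm_iteratedFDeriv_smul_pow_le {d k j : ℕ} {a b c : ℝ} {B : ℝ≥0∞}
    (hc : 0 ≤ c) (h : 𝓢(Euc d, ℂ))
    (hw : ∀ i ≤ k, ∀ x : Euc d, ‖iteratedFDeriv ℝ i (wt a) x‖ ≤ c * (j : ℝ) ^ i * wt a x)
    (hB : ∀ p : Fin j → ℕ, ∑ i, p i ≤ k →
      nrm (1 / 2) (fun x => wt (b + a) x * ∏ i, ‖iteratedFDeriv ℝ (p i) h x‖) ≤ B) :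
    nrm (1 / 2) (fun x => wt b x * ‖iteratedFDeriv ℝ k (fun x => wt a x • h x ^ j) x‖) ≤
      ENNReal.ofReal (2 ^ k * c * (j : ℝ) ^ k) * B := by
  set P : (i : ℕ) → Sym (Fin j) i → Euc d → ℝ := fun i p x =>
    wt (b + a) x * ∏ q, ‖iteratedFDeriv ℝ ((p : Multiset (Fin j)).count q) h x‖ with hP
  set t : ℕ → (i : ℕ) → Sym (Fin j) i → ℝ := fun l i p =>
    k.choose l * c * (j : ℝ) ^ l * (p : Multiset (Fin j)).countPerms with ht
  have ht0 : ∀ l i p, 0 ≤ t l i p := fun l i p => by simp only [ht]; positivity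
  have hPm : ∀ i p, AEStronglyMeasurable (P i p) := fun i p =>
    ((continuous_wt _).mul (continuous_finsetProd _ fun q _ =>
      ((h.smooth _).continuous_iteratedFDeriv le_rfl).norm)).aestronglyMeasurable
  have hpt : ∀ x, wt b x * ‖iteratedFDeriv ℝ k (fun x => wt a x • h x ^ j) x‖ ≤
      ∑ l ∈ Finset.range (k + 1), ∑ p ∈ (Finset.univ : Finset (Fin j)).sym (k - l),
        t l (k - l) p * P (k - l) p x := fun x => by
    have hb := wt_nonneg b x
    have hpow : ∀ n, ‖iteratedFDeriv ℝ n (fun x => h x ^ j) x‖ ≤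
        ∑ p ∈ (Finset.univ : Finset (Fin j)).sym n, (p : Multiset (Fin j)).countPerms *
          ∏ q, ‖iteratedFDeriv ℝ ((p : Multiset (Fin j)).count q) h x‖ := fun n => by
      simpa using norm_iteratedFDeriv_prod_le (𝕜 := ℝ) (u := (Finset.univ : Finset (Fin j)))
        (f := fun _ => h) (N := n) (fun _ _ => h.smooth n) (x := x) le_rfl
    refine (mul_le_mul_of_nonneg_left (norm_iteratedFDeriv_smul_le (N := k) (contDiff_wt a)
      ((h.smooth k).pow j) x le_rfl) hb).trans ?_
    rw [Finset.mul_sum]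
    refine Finset.sum_le_sum fun l hl => ?_
    have hl := Finset.mem_range_succ_iff.1 hl
    calc _ ≤ wt b x * (k.choose l * (c * (j : ℝ) ^ l * wt a x) *
          ∑ p ∈ (Finset.univ : Finset (Fin j)).sym (k - l),
            ((p : Multiset (Fin j)).countPerms : ℝ) *
              ∏ q, ‖iteratedFDeriv ℝ ((p : Multiset (Fin j)).count q) h x‖) := by
          have := wt_nonneg a x
          gcongr
          · exact hw l hl x
          · exact hpow _
      _ = _ := by
          rw [Finset.mul_sum, Finset.mul_sum]
          refine Finset.sum_congr rfl fun p _ => ?_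
          simp only [ht, hP, wt_add]
          ring
  refine (nrm_mono (fun x => mul_nonneg (wt_nonneg _ _) (norm_nonneg _)) hpt).trans ?_
  have hm : ∀ l i p, AEStronglyMeasurable fun x => t l i p * P i p x := fun l i p =>
    (hPm i p).const_mul _
  have hsum : ∑ l ∈ Finset.range (k + 1), ∑ p ∈ (Finset.univ : Finset (Fin j)).sym (k - l),
      t l (k - l) p = 2 ^ k * c * (j : ℝ) ^ k := by
    have e : (2 : ℝ) ^ k = ∑ l ∈ Finset.range (k + 1), (k.choose l : ℝ) := by
      exact_mod_cast (Nat.sum_range_choose k).symm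
    rw [e, Finset.sum_mul, Finset.sum_mul]
    refine Finset.sum_congr rfl fun l hl => ?_
    simp only [ht]
    rw [← Finset.mul_sum, Finset.sum_sym_countPerms, Finset.card_univ, Fintype.card_fin,
      mul_assoc _ ((j : ℝ) ^ l), pow_mul_pow_sub _ (Finset.mem_range_succ_iff.1 hl)]
  rw [← hsum, ENNReal.ofReal_sum_of_nonneg fun l _ => Finset.sum_nonneg fun p _ => ht0 _ _ _,
    Finset.sum_mul]
  refine (nrm_sum_le _ (by norm_num) _ fun l _ =>
    Finset.aestronglyMeasurable_fun_sum _ fun p _ => hm _ _ _).trans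
      (Finset.sum_le_sum fun l hl => ?_)
  rw [ENNReal.ofReal_sum_of_nonneg fun p _ => ht0 _ _ _, Finset.sum_mul]
  refine (nrm_sum_le _ (by norm_num) _ fun p _ => hm _ _ _).trans
    (Finset.sum_le_sum fun p _ => ?_)
  refine (nrm_const_mul_le (ht0 _ _ _) _).trans ?_
  gcongr
  exact hB (fun q => (p : Multiset (Fin j)).count q)
    ((Sym.sum_count_eq p).le.trans (Nat.sub_le k l))

end

/-- the power estimate ‖⟨x⟩^{Cj} h^j‖_{H^{m,m}} ≤ K j^m ‖h‖_{H^{m,m}}^j,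
valid for j ≥ 2 and m ≥ d/2 + 1 + Cj/(j−1). -/
theorem Hmm_power_estimate (d m : ℕ) (hd : 1 ≤ d) :
    ∃ K : ℝ, 0 < K ∧ ∀ (C : ℝ) (j : ℕ), 0 < C → 2 ≤ j →
      (d : ℝ) / 2 + 1 + C * (j : ℝ) / ((j : ℝ) - 1) ≤ (m : ℝ) →
      ∀ h : SchwartzMap (Euc d) ℂ,
        HmmNorm d m (fun x =>
            (((1 + ‖x‖ ^ 2) ^ ((C * (j : ℝ)) / 2) : ℝ) : ℂ) * (h x) ^ j) ≤
          ENNReal.ofReal K * (j : ℝ≥0∞) ^ m * (HmmNorm d m (⇑h)) ^ j := by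
  set s : ℝ := m - d / 2 - 1 with hs_def
  rcases lt_or_ge s 0 with hs | hs
  · refine ⟨1, one_pos, fun C j hC hj hm => ?_⟩
    have hj' : (2 : ℝ) ≤ j := by exact_mod_cast hj
    have : 0 ≤ C * (j : ℝ) / ((j : ℝ) - 1) := div_nonneg (by positivity) (by linarith)
    linarith
  have hsm : s + d / 2 + 1 ≤ m := by rw [hs_def]; linarith
  have hprod : ∀ n, ∃ K : ℝ, 0 ≤ K ∧ (n ≤ m →
      ∀ (j : ℕ) (h : SchwartzMap (Euc d) ℂ) (p : Fin j → ℕ) (b : ℝ), 1 ≤ j → ∑ i, p i = n → b ≤ m - n + (j - 1) * s →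
      nrm (1 / 2) (fun x => wt b x * ∏ i, ‖iteratedFDeriv ℝ (p i) h x‖) ≤
        ENNReal.ofReal K * HmmNorm d m h ^ j) := fun n => by
    by_cases hn : n ≤ m
    · obtain ⟨K, hK, h⟩ := exists_forall_nrm_wt_mul_prod_le d m n hd s hs hsm hn
      exact ⟨K, hK, fun _ => h⟩
    · exact ⟨0, le_rfl, fun h => absurd h hn⟩
  choose K hK0 hK using hprod
  obtain ⟨c, hc, hw⟩ := exists_forall_norm_iteratedFDeriv_wt_le (E := Euc d) m
  set L : ℝ := ∑ n ∈ Finset.range (m + 1), K n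
  have hL : 0 ≤ L := Finset.sum_nonneg fun n _ => hK0 n
  set c' : ℝ := c * (1 + m) ^ m
  set T : ℝ := 2 ^ m * c' * L
  have hT : 0 ≤ T := by positivity
  refine ⟨(m + 1) * T + 1, by positivity, fun C j hC hj hm h => ?_⟩
  have hj1 : 1 ≤ j := by omega
  have hj' : (2 : ℝ) ≤ j := by exact_mod_cast hj
  have hCj0 : 0 ≤ C * j := by positivity
  have hCj : C * j ≤ (j - 1) * s := by
    have : C * (j : ℝ) / ((j : ℝ) - 1) ≤ s := by rw [hs_def]; linarith
    rwa [div_le_iff₀ (by linarith), mul_comm s] at this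
  have hsm' : s ≤ m := by linarith [(Nat.cast_nonneg d : (0 : ℝ) ≤ d)]
  have hCj1 : 1 + |C * j| ≤ (1 + m) * j := by
    rw [abs_of_nonneg hCj0]
    nlinarith [mul_le_mul_of_nonneg_left hsm' (by linarith : (0 : ℝ) ≤ j - 1)]
  have hW : ∀ i ≤ m, ∀ x : Euc d,
      ‖iteratedFDeriv ℝ i (wt (C * j)) x‖ ≤ c' * (j : ℝ) ^ i * wt (C * j) x := fun i hi x => by
    refine (hw i hi _ x).trans ?_
    have := wt_nonneg (C * j) x
    calc _ ≤ c * ((1 + m) * j) ^ i * wt (C * j) x := by gcongr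
      _ = c * (1 + m) ^ i * (j : ℝ) ^ i * wt (C * j) x := by rw [mul_pow]; ring
      _ ≤ _ := by
        simp only [c']
        gcongr
        linarith [(Nat.cast_nonneg m : (0 : ℝ) ≤ m)]
  have e : (fun x : Euc d => (((1 + ‖x‖ ^ 2) ^ ((C * (j : ℝ)) / 2) : ℝ) : ℂ) * (h x) ^ j) =
      fun x => wt (C * j) x • h x ^ j := by
    funext x
    rw [Complex.real_smul, wt]
  rw [e]
  have hk : ∀ k ∈ Finset.range (m + 1), eLpNorm (fun x : Euc d =>
      (1 + ‖x‖ ^ 2) ^ (((m : ℝ) - (k : ℝ)) / 2) *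
        ‖iteratedFDeriv ℝ k (fun x => wt (C * j) x • h x ^ j) x‖) 2 volume ≤
      ENNReal.ofReal T * (j : ℝ≥0∞) ^ m * HmmNorm d m h ^ j := fun k hk => by
    have hk := Finset.mem_range_succ_iff.1 hk
    have hk' : (k : ℝ) ≤ m := by exact_mod_cast hk
    rw [← nrm_half]
    refine (nrm_wt_mul_norm_iteratedFDeriv_smul_pow_le (b := m - k) (c := c')
      (B := ENNReal.ofReal L * HmmNorm d m h ^ j) (by positivity) h
      (fun i hi => hW i (hi.trans hk)) fun p hp => ?_).trans ?_
    · have hpk : ((∑ i, p i : ℕ) : ℝ) ≤ k := by exact_mod_cast hp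
      refine (hK _ (hp.trans hk) j h p _ hj1 rfl (by linarith)).trans ?_
      gcongr
      exact Finset.single_le_sum (fun n _ => hK0 n) (Finset.mem_range_succ_iff.2 (hp.trans hk))
    · have hTk : 2 ^ k * c' * (j : ℝ) ^ k * L ≤ T * (j : ℝ) ^ m := by
        calc _ ≤ 2 ^ m * c' * (j : ℝ) ^ m * L := by
              gcongr
              · norm_num
              · linarith
          _ = _ := by simp only [T]; ring
      rw [← mul_assoc, ← ENNReal.ofReal_mul (by positivity), ← ENNReal.ofReal_natCast j,
        ← ENNReal.ofReal_pow (by positivity), ← ENNReal.ofReal_mul hT]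
      gcongr
  refine (Finset.sum_le_card_nsmul _ _ _ hk).trans ?_
  rw [Finset.card_range, nsmul_eq_mul, ← mul_assoc, ← mul_assoc]
  gcongr
  rw [← ENNReal.ofReal_natCast, ← ENNReal.ofReal_mul (by positivity)]
  gcongr
  push_cast
  linarith
end
end
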